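/- arXiv:math/9805116 — 2 statements merged into one kernel-verified Lean document; each statement's English description precedes it below -/
import Mathlib

section
/- Let A be a weak Hopf algebra over a field K. The following are equivalent: (i) A is a Frobenius algebra, i.e. there exists a K-linear functional f : A → K such that the bilinear form (x, y) ↦ f(xy) is nondegenerate; (ii) dim_K I^R(A) = dim_K A^L, where I^R(A) is the space of right integrals in A; (iii) there exists a nondegenerate left integral in A. -/
open TensorProduct

noncomputable section

variable (K : Type*) [Field K] (A : Type*) [Ring A] [Algebra K A]

/-- `Π^L(x) = Σ ε(1₍₁₎ x) 1₍₂₎`. -/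
def piL (Δ : A →ₗ[K] A ⊗[K] A) (ε : A →ₗ[K] K) : A →ₗ[K] A :=
  (TensorProduct.lid K A).toLinearMap ∘ₗ ε.rTensor A ∘ₗ
    LinearMap.mulLeft K (Δ 1) ∘ₗ (TensorProduct.mk K A A).flip 1

/-- `Π^R(x) = Σ 1₍₁₎ ε(x 1₍₂₎)`. -/
def piR (Δ : A →ₗ[K] A ⊗[K] A) (ε : A →ₗ[K] K) : A →ₗ[K] A :=
  (TensorProduct.rid K A).toLinearMap ∘ₗ ε.lTensor A ∘ₗ
    LinearMap.mulRight K (Δ 1) ∘ₗ TensorProduct.mk K A A 1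

/-- A weak bialgebra structure on the `K`-algebra `A`, with comultiplication `Δ`
and counit `ε`. -/
structure WeakBialgebra (Δ : A →ₗ[K] A ⊗[K] A) (ε : A →ₗ[K] K) : Prop where
  coassoc : ∀ x : A,
    (TensorProduct.assoc K A A A) (Δ.rTensor A (Δ x)) = Δ.lTensor A (Δ x)
  counit_left : ∀ x : A, (TensorProduct.lid K A) (ε.rTensor A (Δ x)) = x
  counit_right : ∀ x : A, (TensorProduct.rid K A) (ε.lTensor A (Δ x)) = x
  comul_mul : ∀ x y : A, Δ (x * y) = Δ x * Δ y
  weak_counit_a : ∀ x y z : A,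
    ε (x * y * z) =
      LinearMap.mul' K K (TensorProduct.map (ε ∘ₗ LinearMap.mulLeft K x)
        (ε ∘ₗ LinearMap.mulRight K z) (Δ y))
  weak_counit_b : ∀ x y z : A,
    ε (x * y * z) =
      LinearMap.mul' K K (TensorProduct.map (ε ∘ₗ LinearMap.mulRight K z)
        (ε ∘ₗ LinearMap.mulLeft K x) (Δ y))
  weak_comul_unit_a :
    Δ.rTensor A (Δ 1) =
      (Δ 1 ⊗ₜ[K] (1 : A)) * ((TensorProduct.assoc K A A A).symm ((1 : A) ⊗ₜ[K] Δ 1))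
  weak_comul_unit_b :
    Δ.rTensor A (Δ 1) =
      ((TensorProduct.assoc K A A A).symm ((1 : A) ⊗ₜ[K] Δ 1)) * (Δ 1 ⊗ₜ[K] (1 : A))

/-- A weak Hopf algebra structure: a weak bialgebra together with an antipode `S`. -/
structure WeakHopfAlgebra (Δ : A →ₗ[K] A ⊗[K] A) (ε : A →ₗ[K] K) (S : A →ₗ[K] A) : Prop where
  toWeakBialgebra : WeakBialgebra K A Δ ε
  antipode_a : ∀ x : A,
    LinearMap.mul' K A (LinearMap.lTensor A S (Δ x)) = piL K A Δ ε x
  antipode_b : ∀ x : A,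
    LinearMap.mul' K A (LinearMap.rTensor A S (Δ x)) = piR K A Δ ε x
  antipode_c : ∀ x : A,
    LinearMap.mul' K A (TensorProduct.map S (LinearMap.mul' K A ∘ₗ LinearMap.lTensor A S)
      (LinearMap.lTensor A Δ (Δ x))) = S x

section SweedlerCalculus

set_option linter.unusedSectionVars false
set_option linter.unusedSimpArgs false

variable {K : Type*} [Field K] {A : Type*} [Ring A] [Algebra K A] [FiniteDimensional K A]
  {M : Type*} [AddCommGroup M] [Module K M] {N : Type*} [AddCommGroup N] [Module K N]

/-- Contraction of the second leg of `Δ x` with a functional `φ`, that is `∑ φ(x₍₂₎) x₍₁₎`. -/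
def contractSnd (Δ : A →ₗ[K] A ⊗[K] A) (φ : A →ₗ[K] K) : A →ₗ[K] A :=
  (TensorProduct.rid K A).toLinearMap ∘ₗ φ.lTensor A ∘ₗ Δ

/-- The Sweedler sum `∑ f(x₍₁₎, x₍₂₎)`, computed by expanding the second leg in a basis. -/
def sweedler (Δ : A →ₗ[K] A ⊗[K] A) (x : A) (f : A → A → M) : M :=
  ∑ i, f (contractSnd Δ ((Module.finBasis K A).coord i) x) (Module.finBasis K A i)

variable {Δ : A →ₗ[K] A ⊗[K] A} {ε : A →ₗ[K] K} {S : A →ₗ[K] A}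

lemma sum_contractSnd_tmul (x : A) :
    ∑ i, contractSnd Δ ((Module.finBasis K A).coord i) x ⊗ₜ[K] Module.finBasis K A i = Δ x := by
  simp only [contractSnd, LinearMap.comp_apply]
  generalize Δ x = t
  induction t with
  | zero => simp
  | tmul a b =>
    simp only [LinearMap.lTensor_tmul, LinearEquiv.coe_coe, TensorProduct.rid_tmul,
      TensorProduct.smul_tmul, ← TensorProduct.tmul_sum]
    congr 1
    exact (Module.finBasis K A).sum_repr b
  | add s t hs ht => simp only [map_add, TensorProduct.add_tmul, Finset.sum_add_distrib, hs, ht]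

/-- Linearity in each of three arguments. -/
structure IsTrilinearMap (K : Type*) [Field K] {A M : Type*} [AddCommGroup A] [Module K A]
    [AddCommGroup M] [Module K M] (f : A → A → A → M) : Prop where
  left : ∀ c, IsBilinearMap K fun a b => f a b c
  right : ∀ a, IsBilinearMap K fun b c => f a b c

lemma sweedler_congr {x : A} {f g : A → A → M} (h : ∀ a b, f a b = g a b) :
    sweedler Δ x f = sweedler Δ x g :=
  Finset.sum_congr rfl fun _ _ => h _ _

lemma map_sweedler (T : M →ₗ[K] N) (x : A) (f : A → A → M) :
    T (sweedler Δ x f) = sweedler Δ x fun a b => T (f a b) := map_sum _ _ _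

lemma mul_sweedler (y x : A) (f : A → A → A) :
    y * sweedler Δ x f = sweedler Δ x fun a b => y * f a b := Finset.mul_sum _ _ _

lemma sweedler_mul (y x : A) (f : A → A → A) :
    sweedler Δ x f * y = sweedler Δ x fun a b => f a b * y := Finset.sum_mul _ _ _

lemma smul_sweedler (c : K) (x : A) (f : A → A → M) :
    c • sweedler Δ x f = sweedler Δ x fun a b => c • f a b := Finset.smul_sum

lemma sweedler_comm (x y : A) (f : A → A → A → A → M) :
    (sweedler Δ x fun a b => sweedler Δ y fun c d => f a b c d) =
      sweedler Δ y fun c d => sweedler Δ x fun a b => f a b c d := Finset.sum_comm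

lemma sweedler_sum {ι : Type*} (s : Finset ι) (x : A) (f : ι → A → A → M) :
    (sweedler Δ x fun a b => ∑ i ∈ s, f i a b) = ∑ i ∈ s, sweedler Δ x (f i) :=
  Finset.sum_comm

lemma sweedler_eq_lift {f : A → A → M} (hf : IsBilinearMap K f) (x : A) :
    sweedler Δ x f = TensorProduct.lift hf.toLinearMap (Δ x) := by
  rw [← sum_contractSnd_tmul, map_sum]; rfl

lemma comul_eq_sweedler (x : A) : Δ x = sweedler Δ x fun a b => a ⊗ₜ[K] b :=
  (sum_contractSnd_tmul x).symm

lemma piL_eq_sweedler (x : A) : piL K A Δ ε x = sweedler Δ 1 fun a b => ε (a * x) • b := by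
  simp [piL, comul_eq_sweedler (Δ := Δ) 1, sweedler, Finset.sum_mul]

lemma piR_eq_sweedler (x : A) : piR K A Δ ε x = sweedler Δ 1 fun a b => ε (x * b) • a := by
  simp [piR, comul_eq_sweedler (Δ := Δ) 1, sweedler, Finset.mul_sum]

lemma IsBilinearMap.exists_eq {f : A → A → M} (hf : IsBilinearMap K f) :
    ∃ F : A →ₗ[K] A →ₗ[K] M, (fun a b => F a b) = f := ⟨hf.toLinearMap, rfl⟩

/-- The linear map on `(A ⊗ A) ⊗ A` attached to a trilinear function. -/
def IsTrilinearMap.lift {f : A → A → A → M} (hf : IsTrilinearMap K f) :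
    (A ⊗[K] A) ⊗[K] A →ₗ[K] M :=
  TensorProduct.lift (TensorProduct.lift (LinearMap.mk₂ K
    (fun a b => ((hf.right a).toLinearMap b))
    (fun a b c => by ext d; exact (hf.left d).add_left a b c)
    (fun a b c => by ext d; exact (hf.left d).smul_left a b c)
    (fun a b c => by ext d; exact (hf.left d).add_right a b c)
    (fun a b c => by ext d; exact (hf.left d).smul_right a b c)))

@[simp] lemma IsTrilinearMap.lift_tmul {f : A → A → A → M} (hf : IsTrilinearMap K f)
    (a b c : A) : hf.lift ((a ⊗ₜ[K] b) ⊗ₜ[K] c) = f a b c := rfl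

namespace WeakBialgebra
variable (h : WeakBialgebra K A Δ ε)
include h

lemma sweedler_counit_left (x : A) (f : A → M)
    (hf : IsLinearMap K f := by
      constructor <;> intros <;>
        simp [sweedler, mul_add, add_mul, smul_add, add_smul, Finset.sum_add_distrib,
          Finset.smul_sum, smul_smul, mul_comm, mul_left_comm]) :
    (sweedler Δ x fun a b => ε a • f b) = f x := by
  obtain ⟨f, rfl⟩ : ∃ g : A →ₗ[K] M, g = f := ⟨hf.mk', rfl⟩
  conv_rhs => rw [← h.counit_left x]
  rw [comul_eq_sweedler (Δ := Δ) x]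
  simp [sweedler]

lemma sweedler_counit_right (x : A) (f : A → M)
    (hf : IsLinearMap K f := by
      constructor <;> intros <;>
        simp [sweedler, mul_add, add_mul, smul_add, add_smul, Finset.sum_add_distrib,
          Finset.smul_sum, smul_smul, mul_comm, mul_left_comm]) :
    (sweedler Δ x fun a b => ε b • f a) = f x := by
  obtain ⟨f, rfl⟩ : ∃ g : A →ₗ[K] M, g = f := ⟨hf.mk', rfl⟩
  conv_rhs => rw [← h.counit_right x]
  rw [comul_eq_sweedler (Δ := Δ) x]
  simp [sweedler]

lemma sweedler_coassoc (x : A) (f : A → A → A → M)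
    (hf : IsTrilinearMap K f := by
      constructor <;> intros <;> constructor <;> intros <;>
        simp [sweedler, mul_add, add_mul, smul_add, add_smul, Finset.sum_add_distrib,
          Finset.smul_sum, smul_smul, mul_comm, mul_left_comm]) :
    (sweedler Δ x fun a c => sweedler Δ a fun a b => f a b c) =
      sweedler Δ x fun a d => sweedler Δ d fun b c => f a b c := by
  have := congrArg (hf.lift ∘ₗ (TensorProduct.assoc K A A A).symm.toLinearMap) (h.coassoc x)
  rw [comul_eq_sweedler (Δ := Δ) x] at this
  simp only [map_sweedler, LinearMap.rTensor_tmul, LinearMap.lTensor_tmul,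
    comul_eq_sweedler (Δ := Δ)] at this
  simpa [sweedler, TensorProduct.sum_tmul, TensorProduct.tmul_sum] using this

lemma sweedler_prod (x y : A) (f : A → A → M)
    (hf : IsBilinearMap K f := by
      constructor <;> intros <;>
        simp [sweedler, mul_add, add_mul, smul_add, add_smul, Finset.sum_add_distrib,
          Finset.smul_sum, smul_smul, mul_comm, mul_left_comm]) :
    sweedler Δ (x * y) f =
      sweedler Δ x fun a b => sweedler Δ y fun c d => f (a * c) (b * d) := by
  rw [sweedler_eq_lift hf, h.comul_mul, comul_eq_sweedler (Δ := Δ) x,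
    comul_eq_sweedler (Δ := Δ) y]
  simp [sweedler, Finset.sum_mul, Finset.mul_sum]
  rw [Finset.sum_comm]
  rfl

lemma sweedler_one_left (f : A → A → A → M)
    (hf : IsTrilinearMap K f := by
      constructor <;> intros <;> constructor <;> intros <;>
        simp [sweedler, mul_add, add_mul, smul_add, add_smul, Finset.sum_add_distrib,
          Finset.smul_sum, smul_smul, mul_comm, mul_left_comm]) :
    (sweedler Δ 1 fun a c => sweedler Δ a fun a b => f a b c) =
      sweedler Δ 1 fun a b => sweedler Δ 1 fun c d => f a (b * c) d := by
  have := congrArg hf.lift h.weak_comul_unit_a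
  rw [comul_eq_sweedler (Δ := Δ) 1] at this
  simp only [map_sweedler, LinearMap.rTensor_tmul, LinearMap.lTensor_tmul,
    comul_eq_sweedler (Δ := Δ)] at this
  rw [sweedler_comm]
  simpa [sweedler, TensorProduct.sum_tmul, TensorProduct.tmul_sum, Finset.sum_mul,
    Finset.mul_sum] using this

lemma sweedler_one_left' (f : A → A → A → M)
    (hf : IsTrilinearMap K f := by
      constructor <;> intros <;> constructor <;> intros <;>
        simp [sweedler, mul_add, add_mul, smul_add, add_smul, Finset.sum_add_distrib,
          Finset.smul_sum, smul_smul, mul_comm, mul_left_comm]) :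
    (sweedler Δ 1 fun a c => sweedler Δ a fun a b => f a b c) =
      sweedler Δ 1 fun a b => sweedler Δ 1 fun c d => f a (c * b) d := by
  have := congrArg hf.lift h.weak_comul_unit_b
  rw [comul_eq_sweedler (Δ := Δ) 1] at this
  simp only [map_sweedler, LinearMap.rTensor_tmul, LinearMap.lTensor_tmul,
    comul_eq_sweedler (Δ := Δ)] at this
  simpa [sweedler, TensorProduct.sum_tmul, TensorProduct.tmul_sum, Finset.sum_mul,
    Finset.mul_sum] using this

lemma counit_mul_mul (x y z : A) :
    ε (x * y * z) = sweedler Δ y fun a b => ε (x * a) * ε (b * z) := by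
  rw [h.weak_counit_a, comul_eq_sweedler (Δ := Δ) y]
  simp [sweedler]

lemma counit_mul_mul' (x y z : A) :
    ε (x * y * z) = sweedler Δ y fun a b => ε (a * z) * ε (x * b) := by
  rw [h.weak_counit_b, comul_eq_sweedler (Δ := Δ) y]
  simp [sweedler]

end WeakBialgebra
end SweedlerCalculus

section WeakBialgebraFacts

set_option linter.unusedSectionVars false
set_option linter.unusedSimpArgs false

variable {K : Type*} [Field K] {A : Type*} [Ring A] [Algebra K A] [FiniteDimensional K A]
  {M : Type*} [AddCommGroup M] [Module K M]
  {Δ : A →ₗ[K] A ⊗[K] A} {ε : A →ₗ[K] K} {S : A →ₗ[K] A}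

lemma sweedler_of_comul_eq {x y p q r s : A}
    (hxy : Δ x = p ⊗ₜ[K] q * Δ y * r ⊗ₜ[K] s) {f : A → A → M} (hf : IsBilinearMap K f) :
    sweedler Δ x f = sweedler Δ y fun a b => f (p * a * r) (q * b * s) := by
  rw [sweedler_eq_lift hf, hxy, comul_eq_sweedler (Δ := Δ) y]
  simp only [sweedler, Finset.mul_sum, Finset.sum_mul, map_sum,
    Algebra.TensorProduct.tmul_mul_tmul]
  rfl

namespace WeakBialgebra
variable (h : WeakBialgebra K A Δ ε)
include h

lemma sweedler_one_mul (x : A) (f : A → A → M)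
    (hf : IsBilinearMap K f := by
      constructor <;> intros <;>
        simp [sweedler, mul_add, add_mul, smul_add, add_smul, Finset.sum_add_distrib,
          Finset.smul_sum, smul_smul, mul_comm, mul_left_comm]) :
    (sweedler Δ 1 fun a b => sweedler Δ x fun c d => f (a * c) (b * d)) = sweedler Δ x f := by
  rw [← h.sweedler_prod 1 x f hf, one_mul]

lemma sweedler_mul_one (x : A) (f : A → A → M)
    (hf : IsBilinearMap K f := by
      constructor <;> intros <;>
        simp [sweedler, mul_add, add_mul, smul_add, add_smul, Finset.sum_add_distrib,
          Finset.smul_sum, smul_smul, mul_comm, mul_left_comm]) :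
    (sweedler Δ 1 fun a b => sweedler Δ x fun c d => f (c * a) (d * b)) = sweedler Δ x f := by
  rw [sweedler_comm, ← h.sweedler_prod x 1 f hf, mul_one]

lemma sweedler_piL_snd (x : A) (f : A → A → M)
    (hf : IsBilinearMap K f := by
      constructor <;> intros <;>
        simp [sweedler, mul_add, add_mul, smul_add, add_smul, Finset.sum_add_distrib,
          Finset.smul_sum, smul_smul, mul_comm, mul_left_comm]) :
    (sweedler Δ x fun a b => f a (piL K A Δ ε b)) = sweedler Δ 1 fun a b => f (a * x) b := by
  obtain ⟨F, rfl⟩ := hf.exists_eq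
  simp only [piL_eq_sweedler, map_sweedler, map_smul]
  symm
  calc sweedler Δ 1 (fun c d => F (c * x) d)
      = sweedler Δ 1 fun c d => sweedler Δ c fun a b => sweedler Δ x fun x1 x2 =>
          ε (b * x2) • F (a * x1) d := by
        refine sweedler_congr fun c d => ?_
        rw [← h.sweedler_prod c x (fun a b => ε b • F a d),
          h.sweedler_counit_right (c * x) (fun a => F a d)]
    _ = sweedler Δ 1 fun a b => sweedler Δ 1 fun c d => sweedler Δ x fun x1 x2 =>
          ε (c * b * x2) • F (a * x1) d :=
        h.sweedler_one_left' fun a b d => sweedler Δ x fun x1 x2 => ε (b * x2) • F (a * x1) d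
    _ = sweedler Δ 1 fun c d => sweedler Δ 1 fun a b => sweedler Δ x fun x1 x2 =>
          ε (c * b * x2) • F (a * x1) d := sweedler_comm ..
    _ = sweedler Δ 1 fun c d => sweedler Δ x fun a b => ε (c * b) • F a d :=
        sweedler_congr fun c d => by
          simpa only [mul_assoc] using h.sweedler_one_mul x (fun a b => ε (c * b) • F a d)
    _ = _ := sweedler_comm ..

lemma sweedler_piR_fst (x : A) (f : A → A → M)
    (hf : IsBilinearMap K f := by
      constructor <;> intros <;>
        simp [sweedler, mul_add, add_mul, smul_add, add_smul, Finset.sum_add_distrib,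
          Finset.smul_sum, smul_smul, mul_comm, mul_left_comm]) :
    (sweedler Δ x fun a b => f (piR K A Δ ε a) b) = sweedler Δ 1 fun a b => f a (x * b) := by
  obtain ⟨F, rfl⟩ := hf.exists_eq
  have key (y b : A) : F (piR K A Δ ε y) b = sweedler Δ 1 fun c d => ε (y * d) • F c b := by
    simp only [piR_eq_sweedler, sweedler, map_sum, map_smul, LinearMap.sum_apply,
      LinearMap.smul_apply]
  simp only [key]
  symm
  calc sweedler Δ 1 (fun c d => F c (x * d))
      = sweedler Δ 1 fun c d => sweedler Δ d fun a b => sweedler Δ x fun x1 x2 =>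
          ε (x1 * a) • F c (x2 * b) := by
        refine sweedler_congr fun c d => ?_
        rw [sweedler_comm, ← h.sweedler_prod x d (fun a b => ε a • F c b),
          h.sweedler_counit_left (x * d) (fun a => F c a)]
    _ = sweedler Δ 1 fun a b => sweedler Δ 1 fun c d => sweedler Δ x fun x1 x2 =>
          ε (x1 * (c * b)) • F a (x2 * d) := by
        rw [← h.sweedler_coassoc 1 fun c a b => sweedler Δ x fun x1 x2 =>
          ε (x1 * a) • F c (x2 * b)]
        exact h.sweedler_one_left' fun c a b => sweedler Δ x fun x1 x2 =>
          ε (x1 * a) • F c (x2 * b)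
    _ = sweedler Δ 1 fun c d => sweedler Δ x fun a b => ε (a * d) • F c b :=
        sweedler_congr fun c d => by
          simpa only [mul_assoc] using h.sweedler_mul_one x (fun a b => ε (a * d) • F c b)
    _ = _ := sweedler_comm ..

lemma sweedler_piR_snd (x : A) (f : A → A → M)
    (hf : IsBilinearMap K f := by
      constructor <;> intros <;>
        simp [sweedler, mul_add, add_mul, smul_add, add_smul, Finset.sum_add_distrib,
          Finset.smul_sum, smul_smul, mul_comm, mul_left_comm]) :
    (sweedler Δ x fun a b => f a (piR K A Δ ε b)) =
      sweedler Δ 1 fun a b => f (x * a) (piR K A Δ ε b) := by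
  obtain ⟨F, rfl⟩ := hf.exists_eq
  have key (y a : A) : F a (piR K A Δ ε y) =
      sweedler Δ 1 fun c d => ε (y * c) • F a (piR K A Δ ε d) := by
    rw [piR_eq_sweedler, map_sweedler]
    simp only [map_smul, piR_eq_sweedler (Δ := Δ), map_sweedler]
    calc (sweedler Δ 1 fun p q => ε (y * q) • F a p)
        = sweedler Δ 1 fun p q => ε (y * 1 * q) • F a p := by simp
      _ = sweedler Δ 1 fun p q => sweedler Δ 1 fun c d => ε (y * c) • ε (d * q) • F a p := by
        refine sweedler_congr fun p q => ?_
        rw [h.counit_mul_mul]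
        simp [sweedler, Finset.sum_smul, smul_smul]
      _ = _ := by
        rw [sweedler_comm]
        refine sweedler_congr fun p q => ?_
        simp [sweedler, Finset.smul_sum]
  calc (sweedler Δ x fun a b => F a (piR K A Δ ε b))
      = sweedler Δ x fun a b => sweedler Δ 1 fun c d => ε (b * c) • F a (piR K A Δ ε d) :=
        sweedler_congr fun a b => key b a
    _ = sweedler Δ 1 fun c d => sweedler Δ x fun a b => ε (b * c) • F a (piR K A Δ ε d) :=
        sweedler_comm ..
    _ = _ := Eq.symm ?_
  calc sweedler Δ 1 (fun c d => F (x * c) (piR K A Δ ε d))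
      = sweedler Δ 1 fun c d => sweedler Δ c fun a b => sweedler Δ x fun x1 x2 =>
          ε (x2 * b) • F (x1 * a) (piR K A Δ ε d) := by
        refine sweedler_congr fun c d => ?_
        rw [sweedler_comm, ← h.sweedler_prod x c (fun a b => ε b • F a (piR K A Δ ε d)),
          h.sweedler_counit_right (x * c) (fun a => F a (piR K A Δ ε d))]
    _ = sweedler Δ 1 fun a b => sweedler Δ 1 fun c d => sweedler Δ x fun x1 x2 =>
          ε (x2 * (b * c)) • F (x1 * a) (piR K A Δ ε d) :=
        h.sweedler_one_left fun a b d => sweedler Δ x fun x1 x2 =>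
          ε (x2 * b) • F (x1 * a) (piR K A Δ ε d)
    _ = sweedler Δ 1 fun c d => sweedler Δ 1 fun a b => sweedler Δ x fun x1 x2 =>
          ε (x2 * (b * c)) • F (x1 * a) (piR K A Δ ε d) := sweedler_comm ..
    _ = _ := sweedler_congr fun c d => by
          simpa only [mul_assoc] using
            h.sweedler_mul_one x (fun a b => ε (b * c) • F a (piR K A Δ ε d))

lemma piL_mul_eq (x : A) : (sweedler Δ x fun a b => piL K A Δ ε a * b) = x := by
  have h1 := h.sweedler_prod 1 x (fun a b => ε a • b)
  rw [one_mul, h.sweedler_counit_left x fun a => a] at h1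
  simp only [piL_eq_sweedler, sweedler_mul]
  rw [sweedler_comm]
  simpa using h1.symm

lemma mul_piR_eq (x : A) : (sweedler Δ x fun a b => a * piR K A Δ ε b) = x := by
  have h1 := h.sweedler_prod x 1 (fun a b => ε b • a)
  rw [mul_one, h.sweedler_counit_right x fun a => a] at h1
  simp only [piR_eq_sweedler, mul_sweedler]
  simpa using h1.symm

lemma piL_one : piL K A Δ ε 1 = 1 := by
  simpa [piL_eq_sweedler] using h.sweedler_counit_left 1 fun a => a

lemma piR_one : piR K A Δ ε 1 = 1 := by
  simpa [piR_eq_sweedler] using h.sweedler_counit_right 1 fun a => a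

lemma counit_mul_piL (x y : A) : ε (x * piL K A Δ ε y) = ε (x * y) := by
  have := h.counit_mul_mul' x 1 y
  rw [mul_one] at this
  simp [this, piL_eq_sweedler, mul_sweedler, map_sweedler]

lemma counit_piR_mul (x y : A) : ε (piR K A Δ ε x * y) = ε (x * y) := by
  have := h.counit_mul_mul' x 1 y
  rw [mul_one] at this
  simp [this, piR_eq_sweedler, sweedler_mul, map_sweedler, mul_comm]

lemma piL_mul_piL (x y : A) : piL K A Δ ε (x * piL K A Δ ε y) = piL K A Δ ε (x * y) := by
  rw [piL_eq_sweedler, piL_eq_sweedler (x * y)]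
  refine sweedler_congr fun a b => ?_
  rw [← mul_assoc, h.counit_mul_piL, mul_assoc]

lemma piR_piR_mul (x y : A) : piR K A Δ ε (piR K A Δ ε x * y) = piR K A Δ ε (x * y) := by
  rw [piR_eq_sweedler, piR_eq_sweedler (x * y)]
  refine sweedler_congr fun a b => ?_
  rw [mul_assoc, h.counit_piR_mul, mul_assoc]

lemma piR_piR (x : A) : piR K A Δ ε (piR K A Δ ε x) = piR K A Δ ε x := by
  simpa using h.piR_piR_mul x 1

lemma piL_mul_piR_comm (x y : A) :
    piL K A Δ ε x * piR K A Δ ε y = piR K A Δ ε y * piL K A Δ ε x := by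
  have h1 := h.sweedler_one_left fun a b c => ε (a * x) • ε (y * c) • b
  rw [h.sweedler_one_left' fun a b c => ε (a * x) • ε (y * c) • b] at h1
  rw [piL_eq_sweedler, piR_eq_sweedler]
  simp only [mul_sweedler, sweedler_mul, smul_mul_assoc, mul_smul_comm, smul_sweedler]
  simp only [smul_comm (ε (y * _)) (ε _)] at h1 ⊢
  exact (sweedler_comm ..).trans h1.symm

lemma comul_piL (x : A) : Δ (piL K A Δ ε x) = (piL K A Δ ε x ⊗ₜ[K] 1) * Δ 1 := by
  have h1 := h.sweedler_one_left (fun a b c => ε (a * x) • (b ⊗ₜ[K] c)) (by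
    constructor <;> intros <;> constructor <;> intros <;>
      simp [mul_add, add_mul, add_smul, smul_smul, TensorProduct.tmul_add,
        TensorProduct.add_tmul, TensorProduct.smul_tmul', mul_comm, mul_left_comm])
  rw [h.sweedler_coassoc 1 (fun a b c => ε (a * x) • (b ⊗ₜ[K] c)) (by
    constructor <;> intros <;> constructor <;> intros <;>
      simp [mul_add, add_mul, add_smul, smul_smul, TensorProduct.tmul_add,
        TensorProduct.add_tmul, TensorProduct.smul_tmul', mul_comm, mul_left_comm])] at h1
  rw [piL_eq_sweedler, map_sweedler]
  simp only [map_smul]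
  simp only [comul_eq_sweedler (Δ := Δ), smul_sweedler]
  rw [h1, sweedler_comm]
  simp [sweedler, Finset.sum_mul, Finset.mul_sum, TensorProduct.tmul_sum, TensorProduct.sum_tmul,
    TensorProduct.smul_tmul']

lemma comul_piL' (x : A) : Δ (piL K A Δ ε x) = Δ 1 * (piL K A Δ ε x ⊗ₜ[K] 1) := by
  have h1 := h.sweedler_one_left' (fun a b c => ε (a * x) • (b ⊗ₜ[K] c)) (by
    constructor <;> intros <;> constructor <;> intros <;>
      simp [mul_add, add_mul, add_smul, smul_smul, TensorProduct.tmul_add,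
        TensorProduct.add_tmul, TensorProduct.smul_tmul', mul_comm, mul_left_comm])
  rw [h.sweedler_coassoc 1 (fun a b c => ε (a * x) • (b ⊗ₜ[K] c)) (by
    constructor <;> intros <;> constructor <;> intros <;>
      simp [mul_add, add_mul, add_smul, smul_smul, TensorProduct.tmul_add,
        TensorProduct.add_tmul, TensorProduct.smul_tmul', mul_comm, mul_left_comm])] at h1
  rw [piL_eq_sweedler, map_sweedler]
  simp only [map_smul]
  simp only [comul_eq_sweedler (Δ := Δ), smul_sweedler]
  rw [h1]
  simp [sweedler, Finset.sum_mul, Finset.mul_sum, TensorProduct.tmul_sum, TensorProduct.sum_tmul,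
    TensorProduct.smul_tmul']

lemma comul_piR (x : A) : Δ (piR K A Δ ε x) = (1 ⊗ₜ[K] piR K A Δ ε x) * Δ 1 := by
  have h1 := h.sweedler_one_left' (fun a b c => ε (x * c) • (a ⊗ₜ[K] b)) (by
    constructor <;> intros <;> constructor <;> intros <;>
      simp [mul_add, add_mul, add_smul, smul_smul, TensorProduct.tmul_add,
        TensorProduct.add_tmul, TensorProduct.smul_tmul', mul_comm, mul_left_comm])
  rw [piR_eq_sweedler, map_sweedler]
  simp only [map_smul]
  simp only [comul_eq_sweedler (Δ := Δ), smul_sweedler]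
  rw [h1]
  simp [sweedler, Finset.sum_mul, Finset.mul_sum, TensorProduct.tmul_sum, TensorProduct.sum_tmul,
    TensorProduct.smul_tmul']

lemma comul_piR' (x : A) : Δ (piR K A Δ ε x) = Δ 1 * (1 ⊗ₜ[K] piR K A Δ ε x) := by
  have h1 := h.sweedler_one_left (fun a b c => ε (x * c) • (a ⊗ₜ[K] b)) (by
    constructor <;> intros <;> constructor <;> intros <;>
      simp [mul_add, add_mul, add_smul, smul_smul, TensorProduct.tmul_add,
        TensorProduct.add_tmul, TensorProduct.smul_tmul', mul_comm, mul_left_comm])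
  rw [piR_eq_sweedler, map_sweedler]
  simp only [map_smul]
  simp only [comul_eq_sweedler (Δ := Δ), smul_sweedler]
  rw [h1, sweedler_comm]
  simp [sweedler, Finset.sum_mul, Finset.mul_sum, TensorProduct.tmul_sum, TensorProduct.sum_tmul,
    TensorProduct.smul_tmul']

lemma sweedler_piL_mul (x y : A) (f : A → A → M)
    (hf : IsBilinearMap K f := by
      constructor <;> intros <;>
        simp [sweedler, mul_add, add_mul, smul_add, add_smul, Finset.sum_add_distrib,
          Finset.smul_sum, smul_smul, mul_comm, mul_left_comm]) :
    sweedler Δ (piL K A Δ ε x * y) f = sweedler Δ y fun a b => f (piL K A Δ ε x * a) b := by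
  have := sweedler_of_comul_eq (y := y) (p := piL K A Δ ε x) (q := 1) (r := 1) (s := 1)
    (show Δ (piL K A Δ ε x * y) = _ by
      rw [h.comul_mul, h.comul_piL, mul_assoc, ← h.comul_mul, one_mul,
        ← Algebra.TensorProduct.one_def, mul_one]) hf
  simpa using this

lemma sweedler_mul_piL (x y : A) (f : A → A → M)
    (hf : IsBilinearMap K f := by
      constructor <;> intros <;>
        simp [sweedler, mul_add, add_mul, smul_add, add_smul, Finset.sum_add_distrib,
          Finset.smul_sum, smul_smul, mul_comm, mul_left_comm]) :
    sweedler Δ (y * piL K A Δ ε x) f = sweedler Δ y fun a b => f (a * piL K A Δ ε x) b := by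
  have := sweedler_of_comul_eq (y := y) (p := 1) (q := 1) (r := piL K A Δ ε x) (s := 1)
    (show Δ (y * piL K A Δ ε x) = _ by
      rw [h.comul_mul, h.comul_piL', ← mul_assoc, ← h.comul_mul, mul_one,
        ← Algebra.TensorProduct.one_def, one_mul]) hf
  simpa using this

lemma sweedler_piR_mul (x y : A) (f : A → A → M)
    (hf : IsBilinearMap K f := by
      constructor <;> intros <;>
        simp [sweedler, mul_add, add_mul, smul_add, add_smul, Finset.sum_add_distrib,
          Finset.smul_sum, smul_smul, mul_comm, mul_left_comm]) :
    sweedler Δ (piR K A Δ ε x * y) f = sweedler Δ y fun a b => f a (piR K A Δ ε x * b) := by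
  have := sweedler_of_comul_eq (y := y) (p := 1) (q := piR K A Δ ε x) (r := 1) (s := 1)
    (show Δ (piR K A Δ ε x * y) = _ by
      rw [h.comul_mul, h.comul_piR, mul_assoc, ← h.comul_mul, one_mul,
        ← Algebra.TensorProduct.one_def, mul_one]) hf
  simpa using this

lemma sweedler_mul_piR (x y : A) (f : A → A → M)
    (hf : IsBilinearMap K f := by
      constructor <;> intros <;>
        simp [sweedler, mul_add, add_mul, smul_add, add_smul, Finset.sum_add_distrib,
          Finset.smul_sum, smul_smul, mul_comm, mul_left_comm]) :
    sweedler Δ (y * piR K A Δ ε x) f = sweedler Δ y fun a b => f a (b * piR K A Δ ε x) := by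
  have := sweedler_of_comul_eq (y := y) (p := 1) (q := 1) (r := 1) (s := piR K A Δ ε x)
    (show Δ (y * piR K A Δ ε x) = _ by
      rw [h.comul_mul, h.comul_piR', ← mul_assoc, ← h.comul_mul, mul_one,
        ← Algebra.TensorProduct.one_def, one_mul]) hf
  simpa using this

end WeakBialgebra
end WeakBialgebraFacts

section AntipodeFacts

set_option linter.unusedSectionVars false
set_option linter.unusedSimpArgs false

variable {K : Type*} [Field K] {A : Type*} [Ring A] [Algebra K A] [FiniteDimensional K A]
  {M : Type*} [AddCommGroup M] [Module K M]
  {Δ : A →ₗ[K] A ⊗[K] A} {ε : A →ₗ[K] K} {S : A →ₗ[K] A}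

namespace WeakBialgebra
variable (h : WeakBialgebra K A Δ ε)
include h

lemma exists_piL_eq_piL_piR (y : A) : ∃ u, piL K A Δ ε y = piL K A Δ ε (piR K A Δ ε u) := by
  refine ⟨sweedler Δ 1 fun a b => ε (b * y) • a, ?_⟩
  have h1 := h.sweedler_piR_fst 1 (fun a b => ε (b * y) • piL K A Δ ε a)
  simp only [one_mul] at h1
  simp only [map_sweedler, map_smul]
  rw [h1]
  simp only [piL_eq_sweedler (Δ := Δ), smul_sweedler]
  rw [sweedler_comm]
  refine sweedler_congr fun a b => ?_
  have h2 := h.counit_mul_mul a 1 y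
  rw [mul_one] at h2
  simp [h2, sweedler, Finset.sum_smul, smul_smul, mul_comm]

lemma exists_piR_eq_piR_piL (y : A) : ∃ u, piR K A Δ ε y = piR K A Δ ε (piL K A Δ ε u) := by
  refine ⟨sweedler Δ 1 fun a b => ε (y * a) • b, ?_⟩
  have h1 := h.sweedler_piL_snd 1 (fun a b => ε (y * a) • piR K A Δ ε b)
  simp only [mul_one] at h1
  simp only [map_sweedler, map_smul]
  rw [h1]
  simp only [piR_eq_sweedler (Δ := Δ), smul_sweedler]
  rw [sweedler_comm]
  refine sweedler_congr fun a b => ?_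
  have h2 := h.counit_mul_mul y 1 b
  rw [mul_one] at h2
  simp [h2, sweedler, Finset.sum_smul, smul_smul, mul_comm]

end WeakBialgebra

namespace WeakHopfAlgebra
variable (h : WeakHopfAlgebra K A Δ ε S)
include h

lemma mul_antipode (x : A) : (sweedler Δ x fun a b => a * S b) = piL K A Δ ε x := by
  rw [← h.antipode_a, comul_eq_sweedler (Δ := Δ) x]
  simp [sweedler]

lemma antipode_mul (x : A) : (sweedler Δ x fun a b => S a * b) = piR K A Δ ε x := by
  rw [← h.antipode_b, comul_eq_sweedler (Δ := Δ) x]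
  simp [sweedler]

lemma antipode_mul_piL (x : A) : (sweedler Δ x fun a b => S a * piL K A Δ ε b) = S x := by
  rw [← h.antipode_c, comul_eq_sweedler (Δ := Δ) x]
  simp [sweedler, h.antipode_a]

lemma piR_mul_antipode (x : A) : (sweedler Δ x fun a b => piR K A Δ ε a * S b) = S x := by
  rw [← h.antipode_mul_piL]
  simp only [← h.antipode_mul, ← h.mul_antipode, sweedler_mul, mul_sweedler]
  simpa only [mul_assoc] using
    h.toWeakBialgebra.sweedler_coassoc x fun a b c => S a * b * S c

lemma antipode_piL (y : A) : S (piL K A Δ ε y) = piR K A Δ ε (piL K A Δ ε y) := by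
  have w := h.toWeakBialgebra
  rw [← h.antipode_mul_piL, ← h.antipode_mul]
  have h1 := w.sweedler_mul_piL y 1 (fun a b => S a * piL K A Δ ε b)
  have h2 := w.sweedler_mul_piL y 1 (fun a b => S a * b)
  have h3 := w.sweedler_piL_snd 1 (fun a b => S (a * piL K A Δ ε y) * b)
  simp only [one_mul, mul_one] at h1 h2 h3
  rw [h1, h2, h3]

lemma antipode_piR (y : A) : S (piR K A Δ ε y) = piL K A Δ ε (piR K A Δ ε y) := by
  have w := h.toWeakBialgebra
  rw [← h.piR_mul_antipode, ← h.mul_antipode]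
  have h1 := w.sweedler_piR_mul y 1 (fun a b => piR K A Δ ε a * S b)
  have h2 := w.sweedler_piR_mul y 1 (fun a b => a * S b)
  have h3 := w.sweedler_piR_fst 1 (fun a b => a * S (piR K A Δ ε y * b))
  simp only [one_mul, mul_one] at h1 h2 h3
  rw [h1, h2, h3]

lemma exists_piL_eq_antipode (y : A) : ∃ u, piL K A Δ ε y = S u := by
  obtain ⟨u, hu⟩ := h.toWeakBialgebra.exists_piL_eq_piL_piR y
  exact ⟨_, hu.trans (h.antipode_piR u).symm⟩

lemma exists_piR_eq_antipode (y : A) : ∃ u, piR K A Δ ε y = S u := by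
  obtain ⟨u, hu⟩ := h.toWeakBialgebra.exists_piR_eq_piR_piL y
  exact ⟨_, hu.trans (h.antipode_piL u).symm⟩

lemma piR_antipode (x : A) : piR K A Δ ε (S x) = piR K A Δ ε (piL K A Δ ε x) := by
  have w := h.toWeakBialgebra
  rw [← h.mul_antipode, ← h.piR_mul_antipode, map_sweedler, map_sweedler]
  exact sweedler_congr fun a b => w.piR_piR_mul a _

lemma antipode_mul_piR_mul (x y : A) :
    (sweedler Δ y fun a b => S a * (piR K A Δ ε x * b)) = piR K A Δ ε (x * y) := by
  have w := h.toWeakBialgebra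
  rw [← w.piR_piR_mul, ← h.antipode_mul (piR K A Δ ε x * y),
    w.sweedler_piR_mul x y fun a b => S a * b]

lemma mul_piL_mul_antipode (x y : A) :
    (sweedler Δ x fun a b => a * piL K A Δ ε y * S b) = piL K A Δ ε (x * y) := by
  have w := h.toWeakBialgebra
  rw [← w.piL_mul_piL, ← h.mul_antipode (x * piL K A Δ ε y),
    w.sweedler_mul_piL y x fun a b => a * S b]

/-- The antipode reverses products. -/
lemma antipode_prod (x y : A) : S (x * y) = S y * S x := by
  have w := h.toWeakBialgebra
  calc S (x * y) = sweedler Δ x fun a b => sweedler Δ y fun c d =>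
        piR K A Δ ε (a * c) * S (b * d) := by
        rw [← h.piR_mul_antipode, w.sweedler_prod x y fun a b => piR K A Δ ε a * S b]
    _ = sweedler Δ x fun a b => sweedler Δ y fun c d => sweedler Δ c fun c c' =>
        S c * (piR K A Δ ε a * c') * S (b * d) := by
        simp only [← sweedler_mul, h.antipode_mul_piR_mul]
    _ = sweedler Δ x fun a b => sweedler Δ y fun c d => sweedler Δ d fun c' d =>
        S c * (piR K A Δ ε a * c') * S (b * d) :=
        sweedler_congr fun a b => w.sweedler_coassoc y fun c c' d =>
          S c * (piR K A Δ ε a * c') * S (b * d)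
    _ = sweedler Δ y fun c d => sweedler Δ d fun c' d => sweedler Δ x fun a b =>
        sweedler Δ a fun a a' => S c * (S a * a' * c') * S (b * d) := by
        rw [sweedler_comm]
        refine sweedler_congr fun c d => ?_
        rw [sweedler_comm]
        simp only [← sweedler_mul, ← mul_sweedler, h.antipode_mul]
    _ = sweedler Δ y fun c d => sweedler Δ d fun c' d => sweedler Δ x fun a b =>
        sweedler Δ b fun a' b => S c * (S a * a' * c') * S (b * d) :=
        sweedler_congr fun c d => sweedler_congr fun c' d =>
          w.sweedler_coassoc x fun a a' b => S c * (S a * a' * c') * S (b * d)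
    _ = sweedler Δ y fun c d => sweedler Δ x fun a b => S c * S a * piL K A Δ ε (b * d) := by
        refine sweedler_congr fun c d => ?_
        rw [sweedler_comm]
        refine sweedler_congr fun a b => ?_
        rw [sweedler_comm, ← h.mul_antipode, w.sweedler_prod b d fun a b => a * S b]
        simp only [mul_sweedler, mul_assoc]
    _ = sweedler Δ y fun c d => sweedler Δ x fun a b => sweedler Δ b fun a' b =>
        S c * (S a * a') * piL K A Δ ε d * S b := by
        simp only [← h.mul_piL_mul_antipode, mul_sweedler, mul_assoc]
    _ = sweedler Δ y fun c d => sweedler Δ x fun a b => sweedler Δ a fun a a' =>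
        S c * (S a * a') * piL K A Δ ε d * S b :=
        sweedler_congr fun c d => (w.sweedler_coassoc x fun a a' b =>
          S c * (S a * a') * piL K A Δ ε d * S b).symm
    _ = sweedler Δ y fun c d => sweedler Δ x fun a b =>
        S c * piL K A Δ ε d * (piR K A Δ ε a * S b) := by
        refine sweedler_congr fun c d => sweedler_congr fun a b => ?_
        rw [mul_assoc (S c), ← mul_assoc _ _ (S b), w.piL_mul_piR_comm, ← h.antipode_mul]
        simp only [mul_sweedler, sweedler_mul, mul_assoc]
    _ = S y * S x := by
        simp only [← mul_sweedler, ← sweedler_mul, h.piR_mul_antipode, h.antipode_mul_piL]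

/-- Multiplicative maps out of `A` are determined by their restriction to the image of `S`. -/
lemma eq_of_comp_antipode_eq {B : Type*} [Ring B] [Algebra K B] (g q : A →ₗ[K] B)
    (hg : ∀ x y, g (x * y) = g x * g y) (hq : ∀ x y, q (x * y) = q x * q y)
    (hS : ∀ x, g (S x) = q (S x)) : g = q := by
  have w := h.toWeakBialgebra
  have hR (y : A) : q (piR K A Δ ε y) = g (piR K A Δ ε y) := by
    obtain ⟨u, hu⟩ := h.exists_piR_eq_antipode y
    rw [hu, hS]
  have hL (y : A) : q (piL K A Δ ε y) = g (piL K A Δ ε y) := by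
    obtain ⟨u, hu⟩ := h.exists_piL_eq_antipode y
    rw [hu, hS]
  ext x
  symm
  calc q x = sweedler Δ x fun a b => q a * g (piR K A Δ ε b) := by
        conv_lhs => rw [← w.mul_piR_eq x]
        simp only [map_sweedler, hq, hR]
    _ = sweedler Δ x fun a d => sweedler Δ d fun b c => q a * q (S b) * g c := by
        refine sweedler_congr fun a b => ?_
        rw [← h.antipode_mul, map_sweedler, sweedler, sweedler, Finset.mul_sum]
        simp only [hg, hS, mul_assoc]
    _ = sweedler Δ x fun d c => sweedler Δ d fun a b => q a * q (S b) * g c :=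
        (w.sweedler_coassoc x fun a b c => q a * q (S b) * g c).symm
    _ = sweedler Δ x fun a b => g (piL K A Δ ε a) * g b := by
        refine sweedler_congr fun a b => ?_
        rw [← hL, ← h.mul_antipode, map_sweedler, sweedler, sweedler, Finset.sum_mul]
        simp only [hq]
    _ = g x := by
        conv_rhs => rw [← w.piL_mul_eq x]
        simp only [map_sweedler, hg]

end WeakHopfAlgebra
end AntipodeFacts

section IntegralFacts

set_option linter.unusedSectionVars false
set_option linter.unusedSimpArgs false

variable {K : Type*} [Field K] {A : Type*} [Ring A] [Algebra K A] [FiniteDimensional K A]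
  {M : Type*} [AddCommGroup M] [Module K M]
  {Δ : A →ₗ[K] A ⊗[K] A} {ε : A →ₗ[K] K} {S : A →ₗ[K] A}

namespace WeakHopfAlgebra
variable (h : WeakHopfAlgebra K A Δ ε S)
include h

lemma antipode_pow_prod (k : ℕ) :
    (∀ x y, ((S : Module.End K A) ^ k) (x * y) = (S ^ k) x * (S ^ k) y) ∨
      (∀ x y, ((S : Module.End K A) ^ k) (x * y) = (S ^ k) y * (S ^ k) x) := by
  induction k with
  | zero => simp
  | succ k ih =>
    simp only [pow_succ', Module.End.mul_apply]
    rcases ih with ih | ih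
    · exact Or.inr fun x y => by rw [ih, h.antipode_prod]
    · exact Or.inl fun x y => by rw [ih, h.antipode_prod]

/-- A projection commuting with `S` that is multiplicative and is the identity after applying
a power of `S` is the identity. -/
lemma eq_id_of_pow_comp_eq (p : A →ₗ[K] A) (hp : ∀ x y, p (x * y) = p x * p y)
    (hpS : ∀ x, p (S x) = S (p x)) (k : ℕ)
    (hk : ∀ x, ((S : Module.End K A) ^ k) (p x) = (S ^ k) x) : ∀ x, p x = x := by
  induction k with
  | zero => simpa using hk
  | succ k ih =>
    apply ih
    have hk' (x : A) : ((S : Module.End K A) ^ k) (S (p x)) = (S ^ k) (S x) := by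
      simpa [pow_succ, Module.End.mul_apply] using hk x
    rcases h.antipode_pow_prod k with hm | hm
    · have := h.eq_of_comp_antipode_eq ((S : Module.End K A) ^ k) (((S : Module.End K A) ^ k) ∘ₗ p)
        hm (fun x y => by simp [hp, hm]) (fun x => by simp [hpS, hk'])
      exact fun x => (LinearMap.congr_fun this x).symm
    · have := h.eq_of_comp_antipode_eq
        ((MulOpposite.opLinearEquiv K).toLinearMap ∘ₗ ((S : Module.End K A) ^ k))
        ((MulOpposite.opLinearEquiv K).toLinearMap ∘ₗ ((S : Module.End K A) ^ k) ∘ₗ p)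
        (fun x y => by simp [hm]) (fun x y => by simp [hp, hm]) (fun x => by simp [hpS, hk'])
      exact fun x => MulOpposite.op_injective (LinearMap.congr_fun this x).symm

lemma antipode_injective : Function.Injective S := by
  obtain ⟨m, hm, hm1⟩ := ((LinearMap.eventually_isCompl_ker_pow_range_pow
    (S : Module.End K A)).and (Filter.eventually_ge_atTop 1)).exists
  set T : Module.End K A := S ^ m with hT
  have hTS (x : A) : T (S x) = S (T x) := by
    rw [hT, ← Module.End.mul_apply, ← Module.End.mul_apply, ← pow_succ, ← pow_succ']
  have hinj (a b : A) (ha : a ∈ LinearMap.range T) (hb : b ∈ LinearMap.range T)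
      (hab : T a = T b) : a = b := by
    rw [← sub_eq_zero]
    exact Submodule.disjoint_def.mp hm.disjoint _ (by simp [hab]) (sub_mem ha hb)
  let p : A →ₗ[K] A := Submodule.projection _ _ hm.symm
  have hpr (x : A) : p x ∈ LinearMap.range T := Submodule.projection_apply_mem _ x
  have hTp (x : A) : T (p x) = T x := by
    have : x - p x ∈ LinearMap.ker T := by
      rw [← Submodule.projection_eq_self_sub_projection hm.symm]
      exact Submodule.projection_apply_mem _ x
    have h2 : T (x - p x) = 0 := this
    rw [map_sub, sub_eq_zero] at h2
    exact h2.symm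
  have hpS (x : A) : p (S x) = S (p x) := by
    refine hinj _ _ (hpr _) ?_ (by rw [hTp, hTS, hTS, hTp])
    obtain ⟨y, hy⟩ := hpr x
    exact ⟨S y, by rw [hTS, hy]⟩
  have hp (x y : A) : p (x * y) = p x * p y := by
    refine hinj _ _ (hpr _) ?_ ?_
    · obtain ⟨a, ha⟩ := hpr x
      obtain ⟨b, hb⟩ := hpr y
      rw [← ha, ← hb]
      rcases h.antipode_pow_prod m with hm | hm
      · exact ⟨a * b, hm a b⟩
      · exact ⟨b * a, hm b a⟩
    · rw [hTp]
      rcases h.antipode_pow_prod m with hm | hm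
      · rw [hm, hm, hTp, hTp]
      · rw [hm, hm, hTp, hTp]
  have hid := h.eq_id_of_pow_comp_eq p hp hpS m hTp
  intro x y hxy
  refine hinj x y (hid x ▸ hpr x) (hid y ▸ hpr y) ?_
  obtain ⟨k, rfl⟩ := Nat.exists_eq_add_of_le' hm1
  simp [hT, pow_succ, hxy]

lemma antipode_bijective : Function.Bijective S :=
  ⟨h.antipode_injective, LinearMap.surjective_of_injective h.antipode_injective⟩

lemma finrank_range_piL : Module.finrank K (LinearMap.range (piL K A Δ ε)) =
    Module.finrank K (LinearMap.range (piR K A Δ ε)) := by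
  apply le_antisymm
  · refine LinearMap.finrank_le_finrank_of_injective (f := S.restrict ?_)
      fun x y hxy => Subtype.ext (h.antipode_injective (congrArg Subtype.val hxy))
    rintro _ ⟨x, rfl⟩
    exact ⟨_, (h.antipode_piL x).symm⟩
  · refine LinearMap.finrank_le_finrank_of_injective (f := S.restrict ?_)
      fun x y hxy => Subtype.ext (h.antipode_injective (congrArg Subtype.val hxy))
    rintro _ ⟨x, rfl⟩
    exact ⟨_, (h.antipode_piR x).symm⟩

/-- A left integral intertwines the two actions through the antipode. -/
lemma sweedler_antipode_mul_integral {l : A} (hl : ∀ x, x * l = piL K A Δ ε x * l) (x : A)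
    (f : A → A → M)
    (hf : IsBilinearMap K f := by
      constructor <;> intros <;>
        simp [sweedler, mul_add, add_mul, smul_add, add_smul, Finset.sum_add_distrib,
          Finset.smul_sum, smul_smul, mul_comm, mul_left_comm]) :
    (sweedler Δ l fun a b => f (S x * a) b) = sweedler Δ l fun a b => f a (x * b) := by
  have w := h.toWeakBialgebra
  obtain ⟨F, rfl⟩ := hf.exists_eq
  calc (sweedler Δ l fun a b => F (S x * a) b)
      = sweedler Δ x fun p q => sweedler Δ l fun a b => F (S p * (piL K A Δ ε q * a)) b := by
        rw [sweedler_comm]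
        refine sweedler_congr fun a b => ?_
        rw [← h.antipode_mul_piL x]
        simp [sweedler, Finset.sum_mul, mul_assoc]
    _ = sweedler Δ x fun p q => sweedler Δ (q * l) fun a b => F (S p * a) b := by
        refine sweedler_congr fun p q => ?_
        rw [hl q, w.sweedler_piL_mul q l fun a b => F (S p * a) b]
    _ = sweedler Δ x fun p q => sweedler Δ q fun q r => sweedler Δ l fun a b =>
          F (S p * (q * a)) (r * b) := by
        refine sweedler_congr fun p q => ?_
        rw [w.sweedler_prod q l fun a b => F (S p * a) b]
    _ = sweedler Δ x fun p r => sweedler Δ p fun p q => sweedler Δ l fun a b =>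
          F (S p * (q * a)) (r * b) :=
        (w.sweedler_coassoc x fun p q r => sweedler Δ l fun a b =>
          F (S p * (q * a)) (r * b)).symm
    _ = sweedler Δ x fun p r => sweedler Δ l fun a b => F (piR K A Δ ε p * a) (r * b) := by
        refine sweedler_congr fun p r => ?_
        rw [sweedler_comm]
        refine sweedler_congr fun a b => ?_
        rw [← h.antipode_mul]
        simp [sweedler, Finset.sum_mul, mul_assoc]
    _ = sweedler Δ 1 fun p r => sweedler Δ l fun a b => F (p * a) (x * (r * b)) := by
        have := w.sweedler_piR_fst x fun p r => sweedler Δ l fun a b => F (p * a) (r * b)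
        simpa only [mul_assoc] using this
    _ = _ := w.sweedler_one_mul l fun a b => F a (x * b)

end WeakHopfAlgebra
end IntegralFacts

section IntegralProjection

set_option linter.unusedSectionVars false
set_option linter.unusedSimpArgs false

variable {K : Type*} [Field K] {A : Type*} [Ring A] [Algebra K A] [FiniteDimensional K A]
  {M : Type*} [AddCommGroup M] [Module K M]
  {Δ : A →ₗ[K] A ⊗[K] A} {ε : A →ₗ[K] K} {S : A →ₗ[K] A}

lemma contractSnd_apply (φ : A →ₗ[K] K) (x : A) :
    contractSnd Δ φ x = sweedler Δ x fun a b => φ b • a := by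
  rw [contractSnd, LinearMap.comp_apply, LinearMap.comp_apply, comul_eq_sweedler (Δ := Δ) x]
  simp [sweedler]

lemma sum_coord_smul (F : A →ₗ[K] M) (x : A) :
    ∑ i, (Module.finBasis K A).coord i x • F (Module.finBasis K A i) = F x := by
  conv_rhs => rw [← (Module.finBasis K A).sum_repr x, map_sum]
  simp only [map_smul, Module.Basis.coord_apply]

/-- Moving an endomorphism across the canonical element of `A ⊗ A*`. -/
lemma sum_coord_comp (P : A → (A →ₗ[K] K) → M) (T : A →ₗ[K] A)
    (hP : IsBilinearMap K P := by
      constructor <;> intros <;>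
        simp [sweedler, mul_add, add_mul, smul_add, add_smul, Finset.sum_add_distrib,
          Finset.smul_sum, smul_smul, mul_comm, mul_left_comm]) :
    ∑ i, P (Module.finBasis K A i) ((Module.finBasis K A).coord i ∘ₗ T) =
      ∑ i, P (T (Module.finBasis K A i)) ((Module.finBasis K A).coord i) := by
  obtain ⟨F, rfl⟩ : ∃ F : A →ₗ[K] (A →ₗ[K] K) →ₗ[K] M, (fun a b => F a b) = P :=
    ⟨hP.toLinearMap, rfl⟩
  have h1 (i) : (Module.finBasis K A).coord i ∘ₗ T =
      ∑ j, (Module.finBasis K A).coord i (T (Module.finBasis K A j)) •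
        (Module.finBasis K A).coord j := by
    refine (Module.finBasis K A).ext fun k => ?_
    simp [Finsupp.single_apply]
  simp_rw [h1, map_sum, map_smul]
  rw [Finset.sum_comm]
  refine Finset.sum_congr rfl fun j _ => ?_
  exact sum_coord_smul (F.flip _) _

/-- The projection onto the space of left integrals. -/
def integralProj (Δ : A →ₗ[K] A ⊗[K] A) (S : A →ₗ[K] A) : A →ₗ[K] A :=
  ∑ i, contractSnd Δ ((Module.finBasis K A).coord i ∘ₗ S) ∘ₗ
    LinearMap.mulLeft K (S (Module.finBasis K A i))

lemma integralProj_apply (a : A) : integralProj Δ S a =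
    ∑ i, sweedler Δ (S (Module.finBasis K A i) * a) fun u v =>
      (Module.finBasis K A).coord i (S v) • u := by
  rw [integralProj, LinearMap.sum_apply]
  exact Finset.sum_congr rfl fun i _ => contractSnd_apply _ _

namespace WeakBialgebra
variable (h : WeakBialgebra K A Δ ε)
include h

lemma piR_mul_piR (x y : A) :
    piR K A Δ ε (piR K A Δ ε x * piR K A Δ ε y) = piR K A Δ ε x * piR K A Δ ε y := by
  have h1 := h.sweedler_piR_mul x (piR K A Δ ε y) fun a b => ε b • a
  have h2 := h.sweedler_piR_mul y 1 fun a b => ε (piR K A Δ ε x * b) • a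
  rw [h.sweedler_counit_right _ fun a => a] at h1
  rw [mul_one] at h2
  rw [piR_eq_sweedler (_ * _)]
  simp only [mul_assoc]
  rw [h1, h2]

/-- `1₍₁₎ ⊗ Π^R(1₍₂₎)` commutes with `A^R`. -/
lemma sweedler_piR_separability (y : A) (f : A → A → M)
    (hf : IsBilinearMap K f := by
      constructor <;> intros <;>
        simp [sweedler, mul_add, add_mul, smul_add, add_smul, Finset.sum_add_distrib,
          Finset.smul_sum, smul_smul, mul_comm, mul_left_comm]) :
    (sweedler Δ 1 fun a b => f (piR K A Δ ε y * a) (piR K A Δ ε b)) =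
      sweedler Δ 1 fun a b => f a (piR K A Δ ε b * piR K A Δ ε y) := by
  obtain ⟨F, rfl⟩ := hf.exists_eq
  rw [← h.sweedler_piR_snd (piR K A Δ ε y) fun a b => F a b]
  have h1 := h.sweedler_mul_piR y 1 fun a b => F a (piR K A Δ ε b)
  rw [one_mul] at h1
  rw [h1]
  refine sweedler_congr fun a b => ?_
  rw [← h.piR_piR_mul, h.piR_mul_piR]

lemma sweedler_one_piR_fst (f : A → A → M)
    (hf : IsBilinearMap K f := by
      constructor <;> intros <;>
        simp [sweedler, mul_add, add_mul, smul_add, add_smul, Finset.sum_add_distrib,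
          Finset.smul_sum, smul_smul, mul_comm, mul_left_comm]) :
    (sweedler Δ 1 fun a b => f (piR K A Δ ε a) b) = sweedler Δ 1 f := by
  simpa using h.sweedler_piR_fst 1 f hf

lemma contractSnd_mul_piR (φ : A →ₗ[K] K) (x y : A) :
    contractSnd Δ φ (x * piR K A Δ ε y) =
      contractSnd Δ (φ ∘ₗ LinearMap.mulRight K (piR K A Δ ε y)) x := by
  rw [contractSnd_apply, contractSnd_apply, h.sweedler_mul_piR y x fun a b => φ b • a]
  rfl

/-- The element `∑ ψ(Π^R(1₍₂₎)) 1₍₁₎` of `A^R`. -/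
lemma exists_piR_eq_sweedler (ψ : A →ₗ[K] K) :
    ∃ y, (sweedler Δ 1 fun a b => ψ (piR K A Δ ε b) • a) = piR K A Δ ε y := by
  refine ⟨sweedler Δ 1 fun a b => ψ (piR K A Δ ε b) • a, ?_⟩
  rw [map_sweedler]
  simp only [map_smul]
  exact (h.sweedler_one_piR_fst fun a b => ψ (piR K A Δ ε b) • a).symm

lemma sum_contractSnd_mul_sweedler (t : A) (ψ : A →ₗ[K] K) :
    ∑ i, contractSnd Δ ((Module.finBasis K A).coord i)
      (t * sweedler Δ 1 fun a b => ψ (Module.finBasis K A i * piR K A Δ ε b) • a) =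
    contractSnd Δ ψ t := by
  have h1 (i) : contractSnd Δ ((Module.finBasis K A).coord i)
      (t * sweedler Δ 1 fun a b => ψ (Module.finBasis K A i * piR K A Δ ε b) • a) =
      sweedler Δ t fun p q => sweedler Δ 1 fun a b =>
        (Module.finBasis K A).coord i (q * a) •
          ψ (Module.finBasis K A i * piR K A Δ ε b) • p := by
    obtain ⟨y, hy⟩ := h.exists_piR_eq_sweedler (ψ ∘ₗ LinearMap.mulLeft K (Module.finBasis K A i))
    simp only [LinearMap.comp_apply, LinearMap.mulLeft_apply] at hy
    rw [hy, h.contractSnd_mul_piR, ← hy, contractSnd_apply]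
    refine sweedler_congr fun p q => ?_
    simp only [sweedler, LinearMap.comp_apply, LinearMap.mulRight_apply, Finset.mul_sum,
      map_sum, Finset.sum_smul, mul_smul_comm, map_smul, smul_smul, smul_eq_mul]
    exact Finset.sum_congr rfl fun _ _ => by rw [mul_comm]
  simp only [h1]
  rw [← sweedler_sum, contractSnd_apply]
  refine sweedler_congr fun p q => ?_
  rw [← sweedler_sum]
  have h2 (a b : A) := sum_coord_smul
    (((ψ ∘ₗ LinearMap.mulRight K (piR K A Δ ε b)).smulRight p)) (q * a)
  simp only [LinearMap.smulRight_apply, LinearMap.comp_apply, LinearMap.mulRight_apply] at h2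
  simp only [h2]
  have h3 := congrArg (fun z => ψ (q * z) • p) (h.mul_piR_eq 1)
  simp only [mul_one] at h3
  rw [← h3]
  simp [sweedler, Finset.mul_sum, Finset.sum_smul, mul_assoc]

end WeakBialgebra

namespace WeakHopfAlgebra
variable (h : WeakHopfAlgebra K A Δ ε S)
include h

lemma antipode_mul_contractSnd {l : A} (hl : ∀ x, x * l = piL K A Δ ε x * l) (x : A)
    (φ : A →ₗ[K] K) :
    S x * contractSnd Δ φ l = contractSnd Δ (φ ∘ₗ LinearMap.mulLeft K x) l := by
  rw [contractSnd_apply, contractSnd_apply, mul_sweedler]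
  simpa using h.sweedler_antipode_mul_integral hl x fun a b => φ b • a

lemma sweedler_antipode_mul_snd (x a : A) (f : A → A → M)
    (hf : IsBilinearMap K f := by
      constructor <;> intros <;>
        simp [sweedler, mul_add, add_mul, smul_add, add_smul, Finset.sum_add_distrib,
          Finset.smul_sum, smul_smul, mul_comm, mul_left_comm]) :
    (sweedler Δ x fun p q => sweedler Δ (p * a) fun u v => f u (S v * q)) =
      sweedler Δ a fun u v => f (x * u) (S v) := by
  have w := h.toWeakBialgebra
  obtain ⟨F, rfl⟩ := hf.exists_eq
  calc (sweedler Δ x fun p q => sweedler Δ (p * a) fun u v => F u (S v * q))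
      = sweedler Δ x fun p r => sweedler Δ p fun p q => sweedler Δ a fun u v =>
          F (p * u) (S v * (S q * r)) := by
        refine sweedler_congr fun p r => ?_
        rw [w.sweedler_prod p a fun u v => F u (S v * r)]
        simp only [h.antipode_prod, mul_assoc]
    _ = sweedler Δ x fun p r => sweedler Δ r fun q r => sweedler Δ a fun u v =>
          F (p * u) (S v * (S q * r)) :=
        w.sweedler_coassoc x fun p q r => sweedler Δ a fun u v => F (p * u) (S v * (S q * r))
    _ = sweedler Δ x fun p r => sweedler Δ a fun u v => F (p * u) (S v * piR K A Δ ε r) := by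
        refine sweedler_congr fun p r => ?_
        rw [sweedler_comm]
        refine sweedler_congr fun u v => ?_
        rw [← h.antipode_mul, mul_sweedler, map_sweedler]
    _ = sweedler Δ 1 fun p r => sweedler Δ a fun u v =>
          F (x * p * u) (S v * piR K A Δ ε r) :=
        w.sweedler_piR_snd x fun p r => sweedler Δ a fun u v => F (p * u) (S v * r)
    _ = sweedler Δ 1 fun p r => sweedler Δ a fun u v => F (x * (p * u)) (S (r * v)) := by
        have h1 := w.sweedler_piL_snd 1 fun p r => sweedler Δ a fun u v =>
          F (x * p * u) (S v * piR K A Δ ε r)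
        have h2 := w.sweedler_piL_snd 1 fun p r => sweedler Δ a fun u v =>
          F (x * p * u) (S v * S r)
        simp only [mul_one] at h1 h2
        rw [← h1]
        simp only [← h.antipode_piL]
        rw [h2]
        simp only [h.antipode_prod, mul_assoc]
    _ = _ := w.sweedler_one_mul a fun u v => F (x * u) (S v)

/-- The image of `integralProj` consists of left integrals. -/
lemma mul_integralProj (x a : A) :
    x * integralProj Δ S a = piL K A Δ ε x * integralProj Δ S a := by
  have w := h.toWeakBialgebra
  simp only [integralProj_apply, Finset.mul_sum, mul_sweedler, mul_smul_comm]
  calc ∑ i, (sweedler Δ (S (Module.finBasis K A i) * a) fun u v =>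
        (Module.finBasis K A).coord i (S v) • (x * u))
      = ∑ i, sweedler Δ x fun p q => sweedler Δ (p * (S (Module.finBasis K A i) * a)) fun u v =>
        (Module.finBasis K A).coord i (S v * q) • u :=
        Finset.sum_congr rfl fun i _ => (h.sweedler_antipode_mul_snd x _ fun u v =>
          (Module.finBasis K A).coord i v • u).symm
    _ = ∑ i, sweedler Δ x fun p q =>
          sweedler Δ (p * (S (Module.finBasis K A i * q) * a)) fun u v =>
            (Module.finBasis K A).coord i (S v) • u := by
        rw [← sweedler_sum, ← sweedler_sum]
        exact sweedler_congr fun p q => sum_coord_comp (fun b φ =>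
          sweedler Δ (p * (S b * a)) fun u v => φ (S v) • u) (LinearMap.mulRight K q)
    _ = ∑ i, sweedler Δ (piL K A Δ ε x * (S (Module.finBasis K A i) * a)) fun u v =>
            (Module.finBasis K A).coord i (S v) • u := by
        refine Finset.sum_congr rfl fun i _ => ?_
        rw [← h.mul_antipode]
        simp only [← contractSnd_apply ((Module.finBasis K A).coord i ∘ₗ S), sweedler_mul,
          map_sweedler, h.antipode_prod, mul_assoc, ← LinearMap.comp_apply]
    _ = _ := Finset.sum_congr rfl fun i _ =>
        w.sweedler_piL_mul x _ fun u v => (Module.finBasis K A).coord i (S v) • u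

lemma integralProj_contractSnd {l : A} (hl : ∀ x, x * l = piL K A Δ ε x * l)
    (ψ : A →ₗ[K] K) : integralProj Δ S (contractSnd Δ ψ l) =
      l * sweedler Δ 1 fun a b => ψ (piR K A Δ ε b) • a := by
  have w := h.toWeakBialgebra
  calc integralProj Δ S (contractSnd Δ ψ l)
      = ∑ i, sweedler Δ l fun p q => sweedler Δ p fun u v =>
          (Module.finBasis K A).coord i (S v) • ψ (Module.finBasis K A i * q) • u := by
        rw [integralProj_apply]
        refine Finset.sum_congr rfl fun i _ => ?_
        rw [h.antipode_mul_contractSnd hl, contractSnd_apply]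
        have h1 := contractSnd_apply (Δ := Δ) ((Module.finBasis K A).coord i ∘ₗ S)
        simp only [LinearMap.comp_apply] at h1
        rw [← h1, map_sweedler]
        refine sweedler_congr fun p q => ?_
        rw [map_smul, h1, smul_sweedler]
        exact sweedler_congr fun u v => smul_comm _ _ _
    _ = sweedler Δ l fun p q => sweedler Δ p fun u v => ψ (S v * q) • u := by
        rw [← sweedler_sum]
        refine sweedler_congr fun p q => ?_
        rw [← sweedler_sum]
        refine sweedler_congr fun u v => ?_
        exact sum_coord_smul ((ψ ∘ₗ LinearMap.mulRight K q).smulRight u) (S v)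
    _ = sweedler Δ l fun u w => sweedler Δ w fun v q => ψ (S v * q) • u :=
        w.sweedler_coassoc l fun u v q => ψ (S v * q) • u
    _ = sweedler Δ l fun u w => ψ (piR K A Δ ε w) • u := by
        refine sweedler_congr fun u w => ?_
        rw [← h.antipode_mul]
        simp [sweedler, Finset.sum_smul]
    _ = _ := by
        rw [w.sweedler_piR_snd l fun a b => ψ b • a, mul_sweedler]
        simp only [mul_smul_comm]

lemma sum_contractSnd_integralProj :
    ∑ i, contractSnd Δ ((Module.finBasis K A).coord i)
      (integralProj Δ S (S (Module.finBasis K A i))) = 1 := by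
  have w := h.toWeakBialgebra
  calc ∑ i, contractSnd Δ ((Module.finBasis K A).coord i)
        (integralProj Δ S (S (Module.finBasis K A i)))
      = ∑ i, ∑ j, sweedler Δ (S (Module.finBasis K A i * Module.finBasis K A j)) fun u w =>
          sweedler Δ w fun p q => (Module.finBasis K A).coord i p •
            (Module.finBasis K A).coord j (S q) • u := by
        refine Finset.sum_congr rfl fun i _ => ?_
        rw [integralProj_apply, map_sum]
        refine Finset.sum_congr rfl fun j _ => ?_
        rw [h.antipode_prod, ← w.sweedler_coassoc _ fun u p q =>
          (Module.finBasis K A).coord i p • (Module.finBasis K A).coord j (S q) • u, map_sweedler]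
        refine sweedler_congr fun u v => ?_
        rw [map_smul, contractSnd_apply, smul_sweedler]
        exact sweedler_congr fun u v => smul_comm _ _ _
    _ = ∑ i, ∑ j, sweedler Δ (S (Module.finBasis K A j)) fun u w =>
          sweedler Δ w fun p q => (Module.finBasis K A).coord i p •
            (Module.finBasis K A).coord j (Module.finBasis K A i * S q) • u :=
        Finset.sum_congr rfl fun i _ => (sum_coord_comp (fun b φ =>
          sweedler Δ (S b) fun u w => sweedler Δ w fun p q =>
            (Module.finBasis K A).coord i p • φ (S q) • u)
          (LinearMap.mulLeft K (Module.finBasis K A i))).symm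
    _ = ∑ j, sweedler Δ (S (Module.finBasis K A j)) fun u w =>
          (Module.finBasis K A).coord j (piL K A Δ ε w) • u := by
        rw [Finset.sum_comm]
        refine Finset.sum_congr rfl fun j _ => ?_
        rw [← sweedler_sum]
        refine sweedler_congr fun u w => ?_
        rw [← sweedler_sum, ← h.mul_antipode, map_sweedler, sweedler, sweedler, Finset.sum_smul]
        refine Finset.sum_congr rfl fun k _ => ?_
        exact sum_coord_smul (((Module.finBasis K A).coord j ∘ₗ
          LinearMap.mulRight K (S (Module.finBasis K A k))).smulRight u) _
    _ = sweedler Δ 1 fun a b => ∑ j, (Module.finBasis K A).coord j b •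
          (a * S (Module.finBasis K A j)) := by
        rw [sweedler_sum]
        exact Finset.sum_congr rfl fun j _ => w.sweedler_piL_snd _ fun u w =>
          (Module.finBasis K A).coord j w • u
    _ = 1 := by
        refine Eq.trans ?_ ((h.mul_antipode 1).trans w.piL_one)
        refine sweedler_congr fun a b => ?_
        exact sum_coord_smul (M := A) (LinearMap.mulLeft K a ∘ₗ S) b

end WeakHopfAlgebra
end IntegralProjection

section IntegralEndomorphisms

set_option linter.unusedSectionVars false
set_option linter.unusedSimpArgs false

variable {K : Type*} [Field K] {A : Type*} [Ring A] [Algebra K A] [FiniteDimensional K A]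
  {M : Type*} [AddCommGroup M] [Module K M]
  {Δ : A →ₗ[K] A ⊗[K] A} {ε : A →ₗ[K] K} {S : A →ₗ[K] A}

/-- The element of `A` representing an endomorphism `T` of the space of left integrals as a
right multiplication. -/
def integralMultiplier (Δ : A →ₗ[K] A ⊗[K] A) (S : A →ₗ[K] A) (T : A →ₗ[K] A) : A :=
  ∑ i, contractSnd Δ ((Module.finBasis K A).coord i)
    (T (integralProj Δ S (S (Module.finBasis K A i))))

namespace WeakBialgebra
variable (h : WeakBialgebra K A Δ ε)
include h

lemma contractSnd_counit (x : A) : contractSnd Δ ε x = x := h.counit_right x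

lemma counit_contractSnd (φ : A →ₗ[K] K) (x : A) : ε (contractSnd Δ φ x) = φ x := by
  rw [contractSnd_apply, map_sweedler, ← h.sweedler_counit_left x fun a => φ a]
  refine sweedler_congr fun a b => ?_
  simp [mul_comm]

lemma exists_contractSnd_contractSnd (φ ψ : A →ₗ[K] K) :
    ∃ χ : A →ₗ[K] K, ∀ x, contractSnd Δ φ (contractSnd Δ ψ x) = contractSnd Δ χ x := by
  refine ⟨ψ ∘ₗ (TensorProduct.lid K A).toLinearMap ∘ₗ φ.rTensor A ∘ₗ Δ, fun x => ?_⟩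
  have h1 (b : A) : (ψ ∘ₗ (TensorProduct.lid K A).toLinearMap ∘ₗ φ.rTensor A ∘ₗ Δ) b =
      sweedler Δ b fun p q => φ p * ψ q := by
    simp only [LinearMap.comp_apply]
    rw [comul_eq_sweedler (Δ := Δ) b]
    simp [sweedler]
  rw [contractSnd_apply ψ, contractSnd_apply _ x, map_sweedler]
  have h2 := h.sweedler_coassoc x fun a b c => (φ b * ψ c) • a
  refine Eq.trans ?_ (h2.trans ?_)
  · refine sweedler_congr fun a b => ?_
    rw [map_smul, contractSnd_apply, smul_sweedler]
    simp only [smul_smul, mul_comm]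
  · refine sweedler_congr fun a b => ?_
    rw [h1, sweedler, sweedler, Finset.sum_smul]

end WeakBialgebra

namespace WeakHopfAlgebra
variable (h : WeakHopfAlgebra K A Δ ε S)
include h

lemma integralProj_eq_self {l : A} (hl : ∀ x, x * l = piL K A Δ ε x * l) :
    integralProj Δ S l = l := by
  have w := h.toWeakBialgebra
  have h1 := h.integralProj_contractSnd hl ε
  rw [w.contractSnd_counit] at h1
  rw [h1]
  have h2 (b : A) : ε (piR K A Δ ε b) = ε b := by simpa using w.counit_piR_mul b 1
  simp only [h2]
  rw [w.sweedler_counit_right 1 fun a => a, mul_one]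

lemma antipode_eq_sum_contractSnd (x : A) :
    S x = ∑ i, contractSnd Δ ((Module.finBasis K A).coord i ∘ₗ LinearMap.mulLeft K x)
      (integralProj Δ S (S (Module.finBasis K A i))) := by
  rw [← mul_one (S x), ← h.sum_contractSnd_integralProj, Finset.mul_sum]
  exact Finset.sum_congr rfl fun i _ => h.antipode_mul_contractSnd
    (fun y => h.mul_integralProj y _) x _

variable {T : A →ₗ[K] A}
  (hT : ∀ l, (∀ x, x * l = piL K A Δ ε x * l) → ∀ x, x * T l = piL K A Δ ε x * T l)
  (hTR : ∀ l, (∀ x, x * l = piL K A Δ ε x * l) →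
    ∀ y, T (l * piR K A Δ ε y) = T l * piR K A Δ ε y)
include hT hTR

lemma contractSnd_integral {l : A} (hl : ∀ x, x * l = piL K A Δ ε x * l) (φ : A →ₗ[K] K) :
    contractSnd Δ φ (T l) = contractSnd Δ φ l * integralMultiplier Δ S T := by
  have w := h.toWeakBialgebra
  have h1 : ∑ i, contractSnd Δ ((Module.finBasis K A).coord i)
      (T (integralProj Δ S (S (Module.finBasis K A i) * contractSnd Δ φ l))) =
      contractSnd Δ φ (T l) := by
    refine Eq.trans ?_ (w.sum_contractSnd_mul_sweedler (T l) φ)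
    refine Finset.sum_congr rfl fun i _ => ?_
    rw [h.antipode_mul_contractSnd hl, h.integralProj_contractSnd hl]
    simp only [LinearMap.comp_apply, LinearMap.mulLeft_apply]
    obtain ⟨y, hy⟩ := w.exists_piR_eq_sweedler (φ ∘ₗ LinearMap.mulLeft K (Module.finBasis K A i))
    simp only [LinearMap.comp_apply, LinearMap.mulLeft_apply] at hy
    rw [hy, hTR l hl]
  rw [← h1]
  obtain ⟨x, hx⟩ := h.antipode_bijective.2 (contractSnd Δ φ l)
  rw [← hx, integralMultiplier, Finset.mul_sum]
  simp only [← h.antipode_prod]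
  have h2 (i) : S x * contractSnd Δ ((Module.finBasis K A).coord i)
      (T (integralProj Δ S (S (Module.finBasis K A i)))) =
      contractSnd Δ ((Module.finBasis K A).coord i ∘ₗ LinearMap.mulLeft K x)
        (T (integralProj Δ S (S (Module.finBasis K A i)))) :=
    h.antipode_mul_contractSnd (hT _ fun y => h.mul_integralProj y _) x _
  simp only [h2]
  refine (sum_coord_comp (M := A) (fun b γ => contractSnd Δ γ (T (integralProj Δ S (S b))))
    (LinearMap.mulLeft K x) ⟨?_, ?_, ?_, ?_⟩).symm <;> intros <;>
    simp [contractSnd, LinearMap.lTensor_add, LinearMap.lTensor_smul]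

lemma apply_integral {l : A} (hl : ∀ x, x * l = piL K A Δ ε x * l) :
    T l = l * integralMultiplier Δ S T := by
  have w := h.toWeakBialgebra
  simpa only [w.contractSnd_counit] using h.contractSnd_integral hT hTR hl ε

lemma piL_integralMultiplier :
    piL K A Δ ε (integralMultiplier Δ S T) = integralMultiplier Δ S T := by
  have w := h.toWeakBialgebra
  have h1 (φ : A →ₗ[K] K) (x : A) : contractSnd Δ φ (S x * integralMultiplier Δ S T) =
      contractSnd Δ φ (S x) * integralMultiplier Δ S T := by
    rw [h.antipode_eq_sum_contractSnd x, Finset.sum_mul, map_sum, map_sum, Finset.sum_mul]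
    refine Finset.sum_congr rfl fun i _ => ?_
    have hl : ∀ y, y * integralProj Δ S (S (Module.finBasis K A i)) =
        piL K A Δ ε y * integralProj Δ S (S (Module.finBasis K A i)) :=
      fun y => h.mul_integralProj y _
    obtain ⟨χ, hχ⟩ := w.exists_contractSnd_contractSnd φ
      ((Module.finBasis K A).coord i ∘ₗ LinearMap.mulLeft K x)
    rw [← h.contractSnd_integral hT hTR hl, hχ, hχ, h.contractSnd_integral hT hTR hl]
  obtain ⟨x, hx⟩ := h.antipode_bijective.2 1
  refine ((Module.finBasis K A).ext_elem_iff).2 fun i => ?_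
  have h2 := congrArg ε (h1 ((Module.finBasis K A).coord i) x)
  rw [hx, one_mul, w.counit_contractSnd, contractSnd_apply, sweedler_mul, map_sweedler] at h2
  rw [← Module.Basis.coord_apply, ← Module.Basis.coord_apply, h2, piL_eq_sweedler, map_sweedler]
  refine sweedler_congr fun a b => ?_
  simp [mul_comm]

end WeakHopfAlgebra
end IntegralEndomorphisms

section HomDimension

universe u

set_option linter.unusedSectionVars false

variable {K : Type*} [Field K] {Q : Type*} [Ring Q] [Algebra K Q]
  {M N P P' : Type u}
  [AddCommGroup M] [Module Q M] [Module K M] [IsScalarTower K Q M] [FiniteDimensional K M]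
  [AddCommGroup N] [Module Q N] [Module K N] [IsScalarTower K Q N] [FiniteDimensional K N]
  [AddCommGroup P] [Module Q P] [Module K P] [IsScalarTower K Q P] [FiniteDimensional K P]
  [AddCommGroup P'] [Module Q P'] [Module K P'] [IsScalarTower K Q P'] [FiniteDimensional K P']

instance finiteDimensional_hom : FiniteDimensional K (M →ₗ[Q] N) :=
  FiniteDimensional.of_injective (LinearMap.restrictScalarsₗ K Q M N K)
    (LinearMap.restrictScalars_injective K)

lemma finiteDimensional_submodule (p : Submodule Q M) : FiniteDimensional K p :=
  inferInstanceAs (FiniteDimensional K (p.restrictScalars K))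

lemma finrank_hom_of_equiv_prod_left (e : (P × P') ≃ₗ[Q] M) :
    Module.finrank K (M →ₗ[Q] N) =
      Module.finrank K (P →ₗ[Q] N) + Module.finrank K (P' →ₗ[Q] N) := by
  rw [← Module.finrank_prod]
  exact ((LinearMap.coprodEquiv K).trans (e.congrLeft N K)).finrank_eq.symm

lemma finrank_hom_of_equiv_prod_right (e : (P × P') ≃ₗ[Q] N) :
    Module.finrank K (M →ₗ[Q] N) =
      Module.finrank K (M →ₗ[Q] P) + Module.finrank K (M →ₗ[Q] P') := by
  rw [← Module.finrank_prod]
  let g : (M →ₗ[Q] P × P') ≃ₗ[K] (M →ₗ[Q] N) :=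
    { (LinearEquiv.refl Q M).arrowCongrAddEquiv e with
      map_smul' := fun c f => LinearMap.ext fun x => e.toLinearMap.map_smul_of_tower c (f x) }
  exact ((LinearMap.prodEquiv K).trans g).finrank_eq.symm

/-- A nonzero map between semisimple modules splits off a common nonzero summand. -/
lemma exists_common_summand [IsSemisimpleModule Q M] [IsSemisimpleModule Q N] (f : M →ₗ[Q] N) :
    ∃ D : Submodule Q N, Nonempty ((LinearMap.range f × LinearMap.ker f) ≃ₗ[Q] M) ∧
      Nonempty ((LinearMap.range f × D) ≃ₗ[Q] N) := by
  obtain ⟨C, hC⟩ := exists_isCompl (LinearMap.ker f)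
  obtain ⟨D, hD⟩ := exists_isCompl (LinearMap.range f)
  refine ⟨D, ⟨?_⟩, ⟨Submodule.prodEquivOfIsCompl _ _ hD⟩⟩
  exact ((f.kerComplementEquivRange hC.symm).symm.prodCongr (LinearEquiv.refl Q _)).trans
    (Submodule.prodEquivOfIsCompl _ _ hC.symm)

/-- Semisimple modules `M` and `N` with
`dim Hom(M, M) + dim Hom(N, N) ≤ dim Hom(M, N) + dim Hom(N, M)` are isomorphic. -/
theorem nonempty_linearEquiv_of_finrank_hom_le (n : ℕ) (M N : Type u)
    [AddCommGroup M] [Module Q M] [Module K M] [IsScalarTower K Q M] [FiniteDimensional K M]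
    [AddCommGroup N] [Module Q N] [Module K N] [IsScalarTower K Q N] [FiniteDimensional K N]
    [IsSemisimpleModule Q M] [IsSemisimpleModule Q N]
    (hn : Module.finrank K M + Module.finrank K N ≤ n)
    (hMN : Module.finrank K (M →ₗ[Q] M) + Module.finrank K (N →ₗ[Q] N) ≤
      Module.finrank K (M →ₗ[Q] N) + Module.finrank K (N →ₗ[Q] M)) :
    Nonempty (M ≃ₗ[Q] N) := by
  induction n using Nat.strong_induction_on generalizing M N with
  | _ n ih =>
  have key (M N : Type u)
      [AddCommGroup M] [Module Q M] [Module K M] [IsScalarTower K Q M] [FiniteDimensional K M]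
      [AddCommGroup N] [Module Q N] [Module K N] [IsScalarTower K Q N] [FiniteDimensional K N]
      [IsSemisimpleModule Q M] [IsSemisimpleModule Q N]
      (hn : Module.finrank K M + Module.finrank K N ≤ n)
      (hMN : Module.finrank K (M →ₗ[Q] M) + Module.finrank K (N →ₗ[Q] N) ≤
        Module.finrank K (M →ₗ[Q] N) + Module.finrank K (N →ₗ[Q] M))
      (f : M →ₗ[Q] N) (hf : f ≠ 0) : Nonempty (M ≃ₗ[Q] N) := by
    obtain ⟨D, ⟨e⟩, ⟨e'⟩⟩ := exists_common_summand f
    have : Nontrivial (LinearMap.range f) :=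
      Submodule.nontrivial_iff_ne_bot.2 fun h0 => hf (LinearMap.range_eq_bot.1 h0)
    have := finiteDimensional_submodule (K := K) (LinearMap.range f)
    have := finiteDimensional_submodule (K := K) (LinearMap.ker f)
    have := finiteDimensional_submodule (K := K) D
    have hpos : 0 < Module.finrank K (LinearMap.range f) := Module.finrank_pos
    have d1 := (e.restrictScalars K).finrank_eq
    have d2 := (e'.restrictScalars K).finrank_eq
    rw [Module.finrank_prod] at d1 d2
    rw [finrank_hom_of_equiv_prod_left (K := K) (N := M) e,
      finrank_hom_of_equiv_prod_left (K := K) (N := N) e',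
      finrank_hom_of_equiv_prod_left (K := K) (N := N) e,
      finrank_hom_of_equiv_prod_left (K := K) (N := M) e'] at hMN
    simp only [finrank_hom_of_equiv_prod_right (K := K) (N := M) e,
      finrank_hom_of_equiv_prod_right (K := K) (N := N) e'] at hMN
    obtain ⟨g⟩ := ih (Module.finrank K (LinearMap.ker f) + Module.finrank K D) (by omega)
      (LinearMap.ker f) D le_rfl (by omega)
    exact ⟨e.symm.trans (((LinearEquiv.refl Q _).prodCongr g).trans e')⟩
  by_cases h1 : ∃ f : M →ₗ[Q] N, f ≠ 0
  · obtain ⟨f, hf⟩ := h1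
    exact key M N hn hMN f hf
  by_cases h2 : ∃ f : N →ₗ[Q] M, f ≠ 0
  · obtain ⟨f, hf⟩ := h2
    obtain ⟨g⟩ := key N M (by omega) (by omega) f hf
    exact ⟨g.symm⟩
  push Not at h1 h2
  have s1 : Subsingleton (M →ₗ[Q] N) := ⟨fun a b => (h1 a).trans (h1 b).symm⟩
  have s2 : Subsingleton (N →ₗ[Q] M) := ⟨fun a b => (h2 a).trans (h2 b).symm⟩
  rw [Module.finrank_zero_of_subsingleton (M := M →ₗ[Q] N),
    Module.finrank_zero_of_subsingleton (M := N →ₗ[Q] M)] at hMN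
  have t1 : Subsingleton (M →ₗ[Q] M) := (Module.finrank_zero_iff (R := K)).1 (by omega)
  have t2 : Subsingleton (N →ₗ[Q] N) := (Module.finrank_zero_iff (R := K)).1 (by omega)
  have u1 : Subsingleton M := ⟨fun x y => by
    have := congrArg (fun g : M →ₗ[Q] M => g (x - y)) (t1.elim LinearMap.id 0)
    simpa [sub_eq_zero] using this⟩
  have u2 : Subsingleton N := ⟨fun x y => by
    have := congrArg (fun g : N →ₗ[Q] N => g (x - y)) (t2.elim LinearMap.id 0)
    simpa [sub_eq_zero] using this⟩
  exact ⟨0, 0, fun _ => u1.elim _ _, fun _ => u2.elim _ _⟩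

end HomDimension

section BaseModules

set_option linter.unusedSectionVars false
set_option linter.unusedSimpArgs false

variable {K : Type*} [Field K] {A : Type*} [Ring A] [Algebra K A] [FiniteDimensional K A]
  {M : Type*} [AddCommGroup M] [Module K M]
  {Δ : A →ₗ[K] A ⊗[K] A} {ε : A →ₗ[K] K} {S : A →ₗ[K] A}

namespace WeakBialgebra

/-- The subalgebra `A^R`. -/
def rightBase (h : WeakBialgebra K A Δ ε) : Subalgebra K A where
  carrier := LinearMap.range (piR K A Δ ε)
  mul_mem' := by
    rintro _ _ ⟨x, rfl⟩ ⟨y, rfl⟩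
    exact ⟨_, h.piR_mul_piR x y⟩
  add_mem' := fun hx hy => add_mem hx hy
  algebraMap_mem' := fun r => ⟨r • 1, by rw [map_smul, h.piR_one, Algebra.algebraMap_eq_smul_one]⟩

variable (h : WeakBialgebra K A Δ ε)

instance : IsScalarTower K h.rightBase.op A :=
  ⟨fun c q a => by
    change a * MulOpposite.unop ((c • q : h.rightBase.op) : Aᵐᵒᵖ) =
      c • (a * MulOpposite.unop (q : Aᵐᵒᵖ))
    simp⟩

lemma rightBase_smul_def (q : h.rightBase.op) (a : A) :
    q • a = a * MulOpposite.unop (q : Aᵐᵒᵖ) := rfl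

lemma exists_rightBase_smul_eq (q : h.rightBase.op) :
    ∃ y, ∀ a : A, q • a = a * piR K A Δ ε y := by
  obtain ⟨y, hy⟩ := q.2
  exact ⟨y, fun a => congrArg (a * ·) hy.symm⟩

lemma exists_smul_eq_mul_piR (y : A) :
    ∃ q : h.rightBase.op, ∀ a : A, q • a = a * piR K A Δ ε y :=
  ⟨⟨MulOpposite.op (piR K A Δ ε y), y, rfl⟩, fun _ => rfl⟩

/-- The space of left integrals, as a right `A^R`-module. -/
def leftIntegrals : Submodule h.rightBase.op A where
  carrier := {l | ∀ x, x * l = piL K A Δ ε x * l}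
  zero_mem' := fun x => by simp
  add_mem' := fun ha hb x => by rw [mul_add, mul_add, ha x, hb x]
  smul_mem' := fun q a ha x => by
    rw [rightBase_smul_def, ← mul_assoc, ha x, mul_assoc]

/-- The right regular `A^R`-module. -/
def rightBaseModule : Submodule h.rightBase.op A where
  carrier := LinearMap.range (piR K A Δ ε)
  zero_mem' := zero_mem _
  add_mem' := fun ha hb => add_mem ha hb
  smul_mem' := fun q a ha => by
    obtain ⟨y, hy⟩ := h.exists_rightBase_smul_eq q
    obtain ⟨x, rfl⟩ := ha
    exact ⟨_, (h.piR_mul_piR x y).trans (hy _).symm⟩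

/-- The `A^R`-linear average `m ↦ ∑ g(m 1₍₁₎) Π^R(1₍₂₎)` of a `K`-linear map `g`. -/
def average (g : A →ₗ[K] A) : A →ₗ[h.rightBase.op] A where
  toFun m := sweedler Δ 1 fun a b => g (m * a) * piR K A Δ ε b
  map_add' x y := by simp [sweedler, add_mul, Finset.sum_add_distrib]
  map_smul' q m := by
    obtain ⟨y, hy⟩ := h.exists_rightBase_smul_eq q
    rw [hy, RingHom.id_apply, hy, sweedler_mul]
    simp only [mul_assoc]
    exact h.sweedler_piR_separability y fun a b => g (m * a) * b

lemma average_apply (g : A →ₗ[K] A) (m : A) :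
    h.average g m = sweedler Δ 1 fun a b => g (m * a) * piR K A Δ ε b := rfl

lemma average_mem {N : Submodule h.rightBase.op A} {g : A →ₗ[K] A} (hg : ∀ x, g x ∈ N) (m : A) :
    h.average g m ∈ N := by
  rw [average_apply, sweedler]
  refine Submodule.sum_mem _ fun i _ => ?_
  obtain ⟨q, hq⟩ := h.exists_smul_eq_mul_piR (Module.finBasis K A i)
  rw [← hq]
  exact N.smul_mem q (hg _)

lemma average_eq_self {N : Submodule h.rightBase.op A} {g : A →ₗ[K] A} (hg : ∀ x ∈ N, g x = x)
    {m : A} (hm : m ∈ N) : h.average g m = m := by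
  rw [average_apply, ← h.sweedler_one_piR_fst fun a b => g (m * a) * piR K A Δ ε b]
  have h1 (a : A) : g (m * piR K A Δ ε a) = m * piR K A Δ ε a := by
    obtain ⟨q, hq⟩ := h.exists_smul_eq_mul_piR a
    rw [← hq]
    exact hg _ (N.smul_mem q hm)
  simp only [h1]
  rw [h.sweedler_one_piR_fst fun a b => m * a * piR K A Δ ε b]
  have h2 := congrArg (m * ·) (h.mul_piR_eq 1)
  simp only [mul_sweedler, mul_one, ← mul_assoc] at h2
  exact h2

lemma exists_retraction (N : Submodule h.rightBase.op A) :
    ∃ p : A →ₗ[K] N, ∀ x : N, p x = x := by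
  obtain ⟨p, hp⟩ := (LinearMap.id (R := K) (M := N.restrictScalars K)).exists_extend
  exact ⟨p, fun x => LinearMap.congr_fun hp x⟩

instance : IsSemisimpleModule h.rightBase.op A where
  exists_isCompl N := by
    obtain ⟨p, hp⟩ := h.exists_retraction N
    exact ⟨_, LinearMap.isCompl_of_proj (f := (h.average
      ((N.restrictScalars K).subtype ∘ₗ p)).codRestrict N
        (h.average_mem fun x => (p x).2)) fun x => Subtype.ext (h.average_eq_self
          (fun y hy => congrArg Subtype.val (hp ⟨y, hy⟩)) x.2)⟩

lemma finiteDimensional_submodule_rightBase (N : Submodule h.rightBase.op A) :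
    FiniteDimensional K N := finiteDimensional_submodule N

attribute [local instance] finiteDimensional_submodule_rightBase

lemma finrank_le_finrank_hom_rightBaseModule (N : Submodule h.rightBase.op A) :
    Module.finrank K N ≤ Module.finrank K (N →ₗ[h.rightBase.op] h.rightBaseModule) := by
  obtain ⟨p, hp⟩ := h.exists_retraction N
  let G (ξ : Module.Dual K N) : A →ₗ[K] A := (ξ ∘ₗ p).smulRight 1
  have hG (ξ) (x) : G ξ x = ξ (p x) • 1 := rfl
  have hGmem (ξ) (x) : h.average (G ξ) x ∈ h.rightBaseModule :=
    h.average_mem (fun y => Submodule.smul_of_tower_mem _ _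
      (show (1 : A) ∈ h.rightBaseModule from ⟨1, h.piR_one⟩)) x
  let Φ : Module.Dual K N →ₗ[K] (N →ₗ[h.rightBase.op] h.rightBaseModule) :=
    { toFun := fun ξ => ((h.average (G ξ)).codRestrict _ (hGmem ξ)) ∘ₗ N.subtype
      map_add' := fun ξ η => LinearMap.ext fun x => Subtype.ext <| by
        simp [average_apply, hG, add_smul, add_mul, sweedler, Finset.sum_add_distrib]
      map_smul' := fun c ξ => LinearMap.ext fun x => Subtype.ext <| by
        simp [average_apply, hG, mul_smul, sweedler, Finset.smul_sum] }
  have hΦ (ξ) (x : N) : ε (Φ ξ x : A) = ξ x := by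
    change ε (h.average (G ξ) x) = ξ x
    rw [average_apply, map_sweedler]
    have h1 (b : A) : ε (piR K A Δ ε b) = ε b := by simpa using h.counit_piR_mul b 1
    simp only [hG, smul_mul_assoc, one_mul, map_smul, h1, smul_eq_mul, mul_comm (ξ _)]
    refine (h.sweedler_counit_right 1 fun a => ξ (p (x * a))).trans ?_
    rw [mul_one]
    exact congrArg ξ (hp x)
  rw [← Subspace.dual_finrank_eq (K := K) (V := N)]
  exact LinearMap.finrank_le_finrank_of_injective (f := Φ) fun ξ η hξη =>
    LinearMap.ext fun x => by rw [← hΦ, ← hΦ, hξη]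

lemma finrank_le_finrank_rightBaseModule_hom (N : Submodule h.rightBase.op A) :
    Module.finrank K N ≤ Module.finrank K (h.rightBaseModule →ₗ[h.rightBase.op] N) := by
  let Φ : N →ₗ[K] (h.rightBaseModule →ₗ[h.rightBase.op] N) :=
    { toFun := fun m =>
        { toFun := fun y => ⟨m * y, by
            obtain ⟨y, z, rfl⟩ := y
            obtain ⟨q, hq⟩ := h.exists_smul_eq_mul_piR z
            change (m : A) * piR K A Δ ε z ∈ N
            rw [← hq]
            exact N.smul_mem q m.2⟩
          map_add' := fun y z => Subtype.ext (mul_add _ _ _)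
          map_smul' := fun q y => Subtype.ext (mul_assoc _ _ _).symm }
      map_add' := fun m m' => LinearMap.ext fun y => Subtype.ext (add_mul _ _ _)
      map_smul' := fun c m => LinearMap.ext fun y => Subtype.ext (smul_mul_assoc _ _ _) }
  refine LinearMap.finrank_le_finrank_of_injective (f := Φ) fun m m' hm => Subtype.ext ?_
  have h1 := congrArg Subtype.val (LinearMap.congr_fun hm ⟨1, 1, h.piR_one⟩)
  simpa [Φ] using h1

lemma finrank_hom_rightBaseModule_le :
    Module.finrank K (h.rightBaseModule →ₗ[h.rightBase.op] h.rightBaseModule) ≤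
      Module.finrank K (LinearMap.range (piR K A Δ ε)) := by
  let Φ : (h.rightBaseModule →ₗ[h.rightBase.op] h.rightBaseModule) →ₗ[K]
      LinearMap.range (piR K A Δ ε) :=
    { toFun := fun T => T ⟨1, 1, h.piR_one⟩
      map_add' := fun _ _ => rfl
      map_smul' := fun _ _ => rfl }
  refine LinearMap.finrank_le_finrank_of_injective (f := Φ) fun T T' hT => ?_
  refine LinearMap.ext fun y => ?_
  obtain ⟨y, z, rfl⟩ := y
  obtain ⟨q, hq⟩ := h.exists_smul_eq_mul_piR z
  have h1 : (⟨piR K A Δ ε z, z, rfl⟩ : h.rightBaseModule) =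
      q • ⟨1, 1, h.piR_one⟩ := Subtype.ext (by rw [Submodule.coe_smul, hq, one_mul])
  rw [h1, map_smul, map_smul]
  exact congrArg (q • ·) hT

end WeakBialgebra

namespace WeakHopfAlgebra
variable (h : WeakHopfAlgebra K A Δ ε S)
include h

attribute [local instance] WeakBialgebra.finiteDimensional_submodule_rightBase

lemma finrank_end_leftIntegrals_le :
    Module.finrank K (h.toWeakBialgebra.leftIntegrals →ₗ[h.toWeakBialgebra.rightBase.op]
        h.toWeakBialgebra.leftIntegrals) ≤
      Module.finrank K (LinearMap.range (piL K A Δ ε)) := by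
  have w := h.toWeakBialgebra
  let E : A →ₗ[K] w.leftIntegrals :=
    { toFun := fun a => ⟨integralProj Δ S a, fun x => h.mul_integralProj x a⟩
      map_add' := fun a b => Subtype.ext (map_add _ _ _)
      map_smul' := fun c a => Subtype.ext (map_smul _ _ _) }
  have hE (l) (hl : ∀ x, x * l = piL K A Δ ε x * l) : E l = ⟨l, hl⟩ :=
    Subtype.ext (h.integralProj_eq_self hl)
  let X (T : w.leftIntegrals →ₗ[w.rightBase.op] w.leftIntegrals) : A →ₗ[K] A :=
    { toFun := fun a => T (E a)
      map_add' := fun a b => by simp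
      map_smul' := fun c a => by
        rw [map_smul, RingHom.id_apply, LinearMap.map_smul_of_tower]; rfl }
  have hX (T) (a) : X T a = T (E a) := rfl
  have hX1 (T) : ∀ l, (∀ x, x * l = piL K A Δ ε x * l) →
      ∀ x, x * X T l = piL K A Δ ε x * X T l := fun l _ => (T (E l)).2
  have hX2 (T) : ∀ l, (∀ x, x * l = piL K A Δ ε x * l) →
      ∀ y, X T (l * piR K A Δ ε y) = X T l * piR K A Δ ε y := by
    intro l hl y
    obtain ⟨q, hq⟩ := w.exists_smul_eq_mul_piR y
    have h1 : E (q • l) = q • E l := by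
      rw [hE l hl, hE _ (w.leftIntegrals.smul_mem q hl)]; rfl
    rw [← hq, hX, h1, map_smul, ← hq]; rfl
  let Φ : (w.leftIntegrals →ₗ[w.rightBase.op] w.leftIntegrals) →ₗ[K]
      LinearMap.range (piL K A Δ ε) :=
    { toFun := fun T => ⟨integralMultiplier Δ S (X T), _, h.piL_integralMultiplier (hX1 T) (hX2 T)⟩
      map_add' := fun T T' => Subtype.ext <| by
        simp [integralMultiplier, hX, Finset.sum_add_distrib]
      map_smul' := fun c T => Subtype.ext <| by
        simp [integralMultiplier, hX, Finset.smul_sum] }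
  refine LinearMap.finrank_le_finrank_of_injective (f := Φ) fun T T' hT => ?_
  refine LinearMap.ext fun l => Subtype.ext ?_
  have h1 : integralMultiplier Δ S (X T) = integralMultiplier Δ S (X T') := congrArg Subtype.val hT
  have h2 := h.apply_integral (hX1 T) (hX2 T) l.2
  have h3 := h.apply_integral (hX1 T') (hX2 T') l.2
  rw [← h1, ← h2, hX, hX, hE _ l.2] at h3
  exact h3.symm

/-- If the spaces of left integrals and `A^L` have the same dimension, then the left integrals
form a cyclic right `A^R`-module. -/
lemma exists_generator_leftIntegrals
    (hd : Module.finrank K h.toWeakBialgebra.leftIntegrals =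
      Module.finrank K (LinearMap.range (piL K A Δ ε))) :
    ∃ l, (∀ x, x * l = piL K A Δ ε x * l) ∧
      ∀ l', (∀ x, x * l' = piL K A Δ ε x * l') → ∃ y, l' = l * piR K A Δ ε y := by
  have w := h.toWeakBialgebra
  have h1 := h.finrank_end_leftIntegrals_le
  have h2 := w.finrank_hom_rightBaseModule_le
  have h3 := w.finrank_le_finrank_hom_rightBaseModule w.leftIntegrals
  have h4 := w.finrank_le_finrank_rightBaseModule_hom w.leftIntegrals
  have h5 := h.finrank_range_piL
  obtain ⟨e⟩ := nonempty_linearEquiv_of_finrank_hom_le (K := K) (Q := w.rightBase.op) _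
    w.leftIntegrals w.rightBaseModule le_rfl (by omega)
  refine ⟨e.symm ⟨1, 1, w.piR_one⟩, (e.symm _).2, fun l' hl' => ?_⟩
  obtain ⟨y, hy⟩ := (e ⟨l', hl'⟩).2
  obtain ⟨q, hq⟩ := w.exists_smul_eq_mul_piR y
  refine ⟨y, ?_⟩
  have h6 : e ⟨l', hl'⟩ = q • ⟨1, 1, w.piR_one⟩ :=
    Subtype.ext (by rw [Submodule.coe_smul, hq, one_mul, hy])
  have h7 : (⟨l', hl'⟩ : w.leftIntegrals) = q • e.symm ⟨1, 1, w.piR_one⟩ := by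
    rw [← map_smul, ← h6, e.symm_apply_apply]
  exact (congrArg Subtype.val h7).trans (hq _)

end WeakHopfAlgebra
end BaseModules

section FrobeniusConditions

set_option linter.unusedSectionVars false
set_option linter.unusedSimpArgs false

variable {K : Type*} [Field K] {A : Type*} [Ring A] [Algebra K A] [FiniteDimensional K A]
  {M : Type*} [AddCommGroup M] [Module K M]
  {Δ : A →ₗ[K] A ⊗[K] A} {ε : A →ₗ[K] K} {S : A →ₗ[K] A}

lemma bijective_mul_apply {f : A →ₗ[K] K} (hf : ∀ x, (∀ y, f (x * y) = 0) → x = 0) :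
    Function.Bijective fun x => f ∘ₗ LinearMap.mulLeft K x := by
  let B : A →ₗ[K] Module.Dual K A := LinearMap.mk₂ K (fun x y => f (x * y))
    (by simp [add_mul]) (by simp) (by simp [mul_add]) (by simp)
  have hB : Function.Injective B :=
    (injective_iff_map_eq_zero B).2 fun x hx => hf x fun y => LinearMap.congr_fun hx y
  exact ⟨hB, (LinearMap.injective_iff_surjective_of_finrank_eq_finrank
    Subspace.dual_finrank_eq.symm).1 hB⟩

namespace WeakHopfAlgebra
variable (h : WeakHopfAlgebra K A Δ ε S)
include h

lemma mem_leftIntegrals_iff_antipode {l : A} :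
    (∀ x, x * l = piL K A Δ ε x * l) ↔ ∀ x, S l * x = S l * piR K A Δ ε x := by
  have h1 (x : A) : S (piL K A Δ ε x * l) = S l * piR K A Δ ε (S x) := by
    rw [h.antipode_prod, h.antipode_piL, h.piR_antipode]
  constructor
  · intro hl x
    obtain ⟨x, rfl⟩ := h.antipode_bijective.2 x
    rw [← h1, ← hl, h.antipode_prod]
  · intro hl x
    apply h.antipode_injective
    rw [h1, h.antipode_prod, hl]

lemma finrank_leftIntegrals {J : Submodule K A}
    (hJ : (J : Set A) = {r | ∀ x, r * x = r * piR K A Δ ε x}) :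
    Module.finrank K h.toWeakBialgebra.leftIntegrals = Module.finrank K J := by
  have w := h.toWeakBialgebra
  have h1 : J = (w.leftIntegrals.restrictScalars K).map
      (LinearEquiv.ofBijective S h.antipode_bijective).toLinearMap := by
    ext r
    obtain ⟨l, rfl⟩ := h.antipode_bijective.2 r
    rw [← SetLike.mem_coe, hJ]
    refine h.mem_leftIntegrals_iff_antipode.symm.trans ⟨fun hl => ⟨l, hl, rfl⟩, ?_⟩
    rintro ⟨l', hl', hll'⟩
    exact h.antipode_injective hll' ▸ hl'
  rw [h1, LinearEquiv.finrank_map_eq]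
  rfl

lemma exists_nondegenerate_leftIntegral
    (hd : Module.finrank K h.toWeakBialgebra.leftIntegrals =
      Module.finrank K (LinearMap.range (piL K A Δ ε))) :
    ∃ l, (∀ x, x * l = piL K A Δ ε x * l) ∧
      Function.Bijective fun φ : A →ₗ[K] K => contractSnd Δ φ l := by
  have w := h.toWeakBialgebra
  obtain ⟨l, hl, hgen⟩ := h.exists_generator_leftIntegrals hd
  refine ⟨l, hl, ?_⟩
  let L : Module.Dual K A →ₗ[K] A :=
    { toFun := fun φ => contractSnd Δ φ l
      map_add' := fun φ ψ => by simp [contractSnd, LinearMap.lTensor_add]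
      map_smul' := fun c φ => by simp [contractSnd, LinearMap.lTensor_smul] }
  have hL : Function.Surjective L := by
    intro x
    obtain ⟨x, rfl⟩ := h.antipode_bijective.2 x
    rw [← LinearMap.mem_range, h.antipode_eq_sum_contractSnd x]
    refine Submodule.sum_mem _ fun i _ => ?_
    obtain ⟨y, hy⟩ := hgen _ fun x => h.mul_integralProj x (S (Module.finBasis K A i))
    rw [hy, w.contractSnd_mul_piR]
    exact ⟨_, rfl⟩
  exact ⟨(LinearMap.injective_iff_surjective_of_finrank_eq_finrank
    Subspace.dual_finrank_eq).2 hL, hL⟩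

lemma nondegenerate_of_leftIntegral {l : A} (hl : ∀ x, x * l = piL K A Δ ε x * l)
    {f : A →ₗ[K] K} (hf : contractSnd Δ f l = 1) :
    (∀ x, (∀ y, f (x * y) = 0) → x = 0) ∧ ∀ y, (∀ x, f (x * y) = 0) → y = 0 := by
  have h1 (x : A) (hx : ∀ y, f (x * y) = 0) : x = 0 := by
    have h2 : f ∘ₗ LinearMap.mulLeft K x = 0 := LinearMap.ext hx
    apply h.antipode_injective
    rw [map_zero, ← mul_one (S x), ← hf, h.antipode_mul_contractSnd hl, h2]
    simp [contractSnd]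
  refine ⟨h1, fun y hy => (Module.forall_dual_apply_eq_zero_iff K y).1 fun φ => ?_⟩
  obtain ⟨x, rfl⟩ := (bijective_mul_apply h1).2 φ
  exact hy x

lemma finrank_rightIntegrals_of_nondegenerate {J : Submodule K A}
    (hJ : (J : Set A) = {r | ∀ x, r * x = r * piR K A Δ ε x})
    {f : A →ₗ[K] K} (hf : ∀ x, (∀ y, f (x * y) = 0) → x = 0) :
    Module.finrank K J = Module.finrank K (LinearMap.range (piL K A Δ ε)) := by
  have w := h.toWeakBialgebra
  have hmem (r : A) : r ∈ J ↔ ∀ x, r * x = r * piR K A Δ ε x := by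
    rw [← SetLike.mem_coe, hJ]; rfl
  let Φ : J →ₗ[K] Module.Dual K (LinearMap.range (piR K A Δ ε)) :=
    LinearMap.mk₂ K (fun r y => f ((r : A) * y))
      (by simp [add_mul]) (by simp) (by simp [mul_add]) (by simp)
  have hinj : Function.Injective Φ := (injective_iff_map_eq_zero Φ).2 fun r hr =>
    Subtype.ext (hf r fun x => by
      rw [(hmem r).1 r.2 x]
      exact LinearMap.congr_fun hr ⟨_, x, rfl⟩)
  have hsurj : Function.Surjective Φ := by
    intro ξ
    obtain ⟨r, hr⟩ := (bijective_mul_apply hf).2 (ξ ∘ₗ (piR K A Δ ε).rangeRestrict)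
    have hr' (x : A) : f (r * x) = ξ ⟨piR K A Δ ε x, x, rfl⟩ := LinearMap.congr_fun hr x
    refine ⟨⟨r, (hmem r).2 fun x => sub_eq_zero.1 (hf _ fun y => ?_)⟩, ?_⟩
    · rw [sub_mul, map_sub, mul_assoc, mul_assoc, hr', hr', sub_eq_zero]
      simp only [w.piR_piR_mul]
    · refine LinearMap.ext ?_
      rintro ⟨_, y, rfl⟩
      refine (hr' _).trans ?_
      simp only [w.piR_piR]
  rw [(LinearEquiv.ofBijective Φ ⟨hinj, hsurj⟩).finrank_eq, h.finrank_range_piL]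
  exact Subspace.dual_finrank_eq

end WeakHopfAlgebra
end FrobeniusConditions

/-- For a weak Hopf algebra `A` over a field `K` the following are
equivalent: (i) `A` is a Frobenius algebra (there is a functional `f` with `(x,y) ↦ f(xy)`
nondegenerate); (ii) the space of right integrals has the same `K`-dimension as `A^L`;
(iii) there exists a nondegenerate left integral in `A`. -/
theorem weakHopfAlgebra_frobenius_tfae
    (K : Type*) [Field K] (A : Type*) [Ring A] [Algebra K A] [FiniteDimensional K A]
    (Δ : A →ₗ[K] A ⊗[K] A) (ε : A →ₗ[K] K) (S : A →ₗ[K] A)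
    (hA : WeakHopfAlgebra K A Δ ε S)
    (rightIntegrals : Submodule K A)
    (hRI : (rightIntegrals : Set A) = {r : A | ∀ x : A, r * x = r * piR K A Δ ε x}) :
    ((∃ f : A →ₗ[K] K,
        (∀ x : A, (∀ y : A, f (x * y) = 0) → x = 0) ∧
        (∀ y : A, (∀ x : A, f (x * y) = 0) → y = 0)) ↔
      Module.finrank K rightIntegrals = Module.finrank K (LinearMap.range (piL K A Δ ε))) ∧
    ((∃ f : A →ₗ[K] K,
        (∀ x : A, (∀ y : A, f (x * y) = 0) → x = 0) ∧
        (∀ y : A, (∀ x : A, f (x * y) = 0) → y = 0)) ↔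
      ∃ l : A, (∀ x : A, x * l = piL K A Δ ε x * l) ∧
        Function.Bijective
          (fun φ : A →ₗ[K] K => (TensorProduct.rid K A) (LinearMap.lTensor A φ (Δ l)))) := by
  have frob_of_int : (∃ l : A, (∀ x : A, x * l = piL K A Δ ε x * l) ∧
      Function.Bijective
        (fun φ : A →ₗ[K] K => (TensorProduct.rid K A) (LinearMap.lTensor A φ (Δ l)))) →
      ∃ f : A →ₗ[K] K, (∀ x : A, (∀ y : A, f (x * y) = 0) → x = 0) ∧
        (∀ y : A, (∀ x : A, f (x * y) = 0) → y = 0) := by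
    rintro ⟨l, hl, -, hsurj⟩
    obtain ⟨f, hf⟩ := hsurj 1
    exact ⟨f, hA.nondegenerate_of_leftIntegral hl hf⟩
  have int_of_finrank (hd : Module.finrank K rightIntegrals =
      Module.finrank K (LinearMap.range (piL K A Δ ε))) :
      ∃ l : A, (∀ x : A, x * l = piL K A Δ ε x * l) ∧
      Function.Bijective
        (fun φ : A →ₗ[K] K => (TensorProduct.rid K A) (LinearMap.lTensor A φ (Δ l))) :=
    hA.exists_nondegenerate_leftIntegral ((hA.finrank_leftIntegrals hRI).trans hd)
  have finrank_of_frob : (∃ f : A →ₗ[K] K, (∀ x : A, (∀ y : A, f (x * y) = 0) → x = 0) ∧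
        (∀ y : A, (∀ x : A, f (x * y) = 0) → y = 0)) →
      Module.finrank K rightIntegrals = Module.finrank K (LinearMap.range (piL K A Δ ε)) := by
    rintro ⟨f, hf, -⟩
    exact hA.finrank_rightIntegrals_of_nondegenerate hRI hf
  exact ⟨⟨finrank_of_frob, fun hd => frob_of_int (int_of_finrank hd)⟩,
    ⟨fun hf => int_of_finrank (finrank_of_frob hf), frob_of_int⟩⟩
end
end

section
/- (Duality of left integrals) Let A be a weak Hopf algebra over a field K, let l be a left integral in A, and suppose λ ∈ A* = Hom_K(A, K) satisfies Σ l₍₁₎ λ(l₍₂₎) = 1. Then: λ is the unique element of A* with this property; Σ x₍₁₎ λ(x₍₂₎) = Σ Π^L(x₍₁₎) λ(x₍₂₎) for all x ∈ A (λ is a left integral in the dual weak Hopf algebra); the map A* → A, φ ↦ Σ l₍₁₎ φ(l₍₂₎), is bijective (l is nondegenerate); the bilinear form (x, y) ↦ λ(xy) is nondegenerate; and λ(x l) = ε(x) for all x ∈ A. -/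
open TensorProduct

noncomputable section

variable (K : Type*) [Field K] (A : Type*) [Ring A] [Algebra K A]

namespace WeakHopf

open Coalgebra LinearMap

section Convolution

variable {K C B E : Type*} [Field K] [AddCommGroup C] [Module K C] [Coalgebra K C]
  [Ring B] [Algebra K B] [Ring E] [Algebra K E]

/-- The convolution product `x ↦ Σ f(x₍₁₎) g(x₍₂₎)`. -/
def conv (f g : C →ₗ[K] B) : C →ₗ[K] B :=
  mul' K B ∘ₗ TensorProduct.map f g ∘ₗ comul

local infixl:70 "⋆" => conv

theorem conv_apply (f g : C →ₗ[K] B) (c : C) :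
    (f ⋆ g) c = mul' K B (TensorProduct.map f g (comul c)) := rfl

theorem conv_repr (f g : C →ₗ[K] B) {c : C} {ι : Type*} (R : Coalgebra.Repr K c ι) :
    (f ⋆ g) c = ∑ i ∈ R.index, f (R.left i) * g (R.right i) := by
  simp [conv_apply, ← R.eq]

theorem conv_assoc (f g k : C →ₗ[K] B) : f ⋆ g ⋆ k = f ⋆ (g ⋆ k) :=
  congrArg WithConv.ofConv
    (mul_assoc (WithConv.toConv f) (WithConv.toConv g) (WithConv.toConv k))

theorem comp_conv_of_map_mul (φ : B →ₗ[K] E) (hφ : ∀ x y, φ (x * y) = φ x * φ y)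
    (f g : C →ₗ[K] B) : φ ∘ₗ (f ⋆ g) = (φ ∘ₗ f) ⋆ (φ ∘ₗ g) := by
  ext c
  simp [conv_repr _ _ (ℛ K c), hφ]

theorem conv_comp_of_comul {D : Type*} [AddCommGroup D] [Module K D] [Coalgebra K D]
    (φ : D →ₗ[K] C) (hφ : ∀ d, comul (R := K) (φ d) = TensorProduct.map φ φ (comul d))
    (f g : C →ₗ[K] B) : (f ⋆ g) ∘ₗ φ = (f ∘ₗ φ) ⋆ (g ∘ₗ φ) := by
  ext d
  simp [conv_apply, hφ, TensorProduct.map_map]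

theorem mulLeft_comp_conv (b : B) (f g : C →ₗ[K] B) :
    mulLeft K b ∘ₗ (f ⋆ g) = (mulLeft K b ∘ₗ f) ⋆ g := by
  ext c
  simp [conv_repr _ _ (ℛ K c), mul_assoc]

theorem mulRight_comp_conv (b : B) (f g : C →ₗ[K] B) :
    mulRight K b ∘ₗ (f ⋆ g) = f ⋆ (mulRight K b ∘ₗ g) := by
  ext c
  simp [conv_repr _ _ (ℛ K c), mul_assoc]

/-- If the convolution inverse conditions are satisfied by both `f` and `g` relative to `m` with
the same idempotents, then `f = g`. -/
theorem conv_inverse_unique {m f g p q : C →ₗ[K] B} (hfm : f ⋆ m = p) (hmf : m ⋆ f = q)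
    (hf : f ⋆ m ⋆ f = f) (hgm : g ⋆ m = p) (hmg : m ⋆ g = q) (hg : g ⋆ m ⋆ g = g) : f = g := by
  rw [← hf, hfm, ← hgm, conv_assoc, hmf, ← hmg, ← conv_assoc, hg]

variable (K) in
/-- The embedding `b ↦ b ⊗ 1`. -/
def incl (B : Type*) [Ring B] [Algebra K B] : B →ₗ[K] B ⊗[K] B :=
  (TensorProduct.mk K B B).flip 1

variable (K) in
/-- The embedding `b ↦ 1 ⊗ b`. -/
def incr (B : Type*) [Ring B] [Algebra K B] : B →ₗ[K] B ⊗[K] B :=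
  TensorProduct.mk K B B 1

@[simp] theorem incl_apply (b : B) : incl K B b = b ⊗ₜ 1 := rfl

@[simp] theorem incr_apply (b : B) : incr K B b = 1 ⊗ₜ b := rfl

theorem incl_conv (f g : C →ₗ[K] B) : incl K B ∘ₗ (f ⋆ g) = (incl K B ∘ₗ f) ⋆ (incl K B ∘ₗ g) :=
  comp_conv_of_map_mul _ (by simp) _ _

theorem incr_conv (f g : C →ₗ[K] B) : incr K B ∘ₗ (f ⋆ g) = (incr K B ∘ₗ f) ⋆ (incr K B ∘ₗ g) :=
  comp_conv_of_map_mul _ (by simp) _ _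

theorem incl_conv_incr (f g : C →ₗ[K] B) :
    (incl K B ∘ₗ f) ⋆ (incr K B ∘ₗ g) = TensorProduct.map f g ∘ₗ comul := by
  ext c
  rw [conv_repr _ _ (ℛ K c), comp_apply, ← (ℛ K c).eq]
  simp

end Convolution

local infixl:70 "⋆" => conv

section Algebra

variable {K A : Type*} [Field K] [Ring A] [Algebra K A]

theorem piL_apply (Δ : A →ₗ[K] A ⊗[K] A) (ε : A →ₗ[K] K) (x : A) :
    piL K A Δ ε x = TensorProduct.lid K A (ε.rTensor A (Δ 1 * x ⊗ₜ 1)) := rfl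

theorem piR_apply (Δ : A →ₗ[K] A ⊗[K] A) (ε : A →ₗ[K] K) (x : A) :
    piR K A Δ ε x = TensorProduct.rid K A (ε.lTensor A (1 ⊗ₜ x * Δ 1)) := rfl

theorem lid_rTensor_lTensor {M N : Type*} [AddCommGroup M] [Module K M] [AddCommGroup N]
    [Module K N] (φ : A →ₗ[K] K) (f : M →ₗ[K] N) (t : A ⊗[K] M) :
    TensorProduct.lid K N (φ.rTensor N (f.lTensor A t)) =
      f (TensorProduct.lid K M (φ.rTensor M t)) := by
  induction t with
  | zero => simp
  | tmul => simp
  | add _ _ h₁ h₂ => simp only [map_add, h₁, h₂]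

theorem rid_lTensor_rTensor {M N : Type*} [AddCommGroup M] [Module K M] [AddCommGroup N]
    [Module K N] (φ : A →ₗ[K] K) (f : M →ₗ[K] N) (t : M ⊗[K] A) :
    TensorProduct.rid K N (φ.lTensor N (f.rTensor A t)) =
      f (TensorProduct.rid K M (φ.lTensor M t)) := by
  induction t with
  | zero => simp
  | tmul => simp
  | add _ _ h₁ h₂ => simp only [map_add, h₁, h₂]

theorem apply_eq_of_mem_range_mapIncl {M : Type*} [AddCommGroup M] [Module K M]
    {C : Submodule K A} {f g : A ⊗[K] A →ₗ[K] M}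
    (hfg : ∀ a ∈ C, ∀ b ∈ C, f (a ⊗ₜ b) = g (a ⊗ₜ b)) {t : A ⊗[K] A}
    (ht : t ∈ range (TensorProduct.mapIncl C C)) : f t = g t := by
  obtain ⟨u, rfl⟩ := ht
  induction u with
  | zero => simp
  | add _ _ h₁ h₂ => simp only [map_add, h₁, h₂]
  | tmul a b => exact hfg a a.2 b b.2

theorem apply_mem_of_mem_range_mapIncl {M : Type*} [AddCommGroup M] [Module K M]
    {C : Submodule K A} {N : Submodule K M} {f : A ⊗[K] A →ₗ[K] M}
    (hf : ∀ a ∈ C, ∀ b ∈ C, f (a ⊗ₜ b) ∈ N) {t : A ⊗[K] A}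
    (ht : t ∈ range (TensorProduct.mapIncl C C)) : f t ∈ N := by
  obtain ⟨u, rfl⟩ := ht
  induction u with
  | zero => simp
  | add _ _ h₁ h₂ => simpa only [map_add] using N.add_mem h₁ h₂
  | tmul a b => exact hf a a.2 b b.2

end Algebra

variable {K A : Type*} [Field K] [Ring A] [Algebra K A] [Coalgebra K A]

local notation "Δ₁" => (comul (R := K) (1 : A))
local notation "πL" => piL K A (comul (R := K) (A := A)) (counit (R := K) (A := A))
local notation "πR" => piR K A (comul (R := K) (A := A)) (counit (R := K) (A := A))
local notation "WBA" => WeakBialgebra K A (comul (R := K) (A := A)) (counit (R := K) (A := A))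

theorem piL_repr {ι : Type*} (R : Coalgebra.Repr K (1 : A) ι) (x : A) :
    πL x = ∑ i ∈ R.index, counit (R := K) (R.left i * x) • R.right i := by
  simp [piL_apply, ← R.eq, Finset.sum_mul]

theorem piR_repr {ι : Type*} (R : Coalgebra.Repr K (1 : A) ι) (x : A) :
    πR x = ∑ i ∈ R.index, counit (R := K) (x * R.right i) • R.left i := by
  simp [piR_apply, ← R.eq, Finset.mul_sum]

theorem lTensor_comul_one (h : WBA) :
    (comul (R := K)).lTensor A Δ₁ = (mulRight K Δ₁ ∘ₗ incl K A).lTensor A Δ₁ := by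
  rw [← h.coassoc, h.weak_comul_unit_a, ← (ℛ K (1 : A)).eq]
  simp [Finset.sum_mul, Finset.mul_sum, TensorProduct.sum_tmul, TensorProduct.tmul_sum]
  rw [Finset.sum_comm]

theorem lTensor_comul_one' (h : WBA) :
    (comul (R := K)).lTensor A Δ₁ = (mulLeft K Δ₁ ∘ₗ incl K A).lTensor A Δ₁ := by
  rw [← h.coassoc, h.weak_comul_unit_b, ← (ℛ K (1 : A)).eq]
  simp [Finset.sum_mul, Finset.mul_sum, TensorProduct.sum_tmul, TensorProduct.tmul_sum]

theorem rTensor_comul_one (h : WBA) :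
    (comul (R := K)).rTensor A Δ₁ = (mulLeft K Δ₁ ∘ₗ incr K A).rTensor A Δ₁ := by
  rw [h.weak_comul_unit_a, ← (ℛ K (1 : A)).eq]
  simp [Finset.sum_mul, Finset.mul_sum, TensorProduct.sum_tmul, TensorProduct.tmul_sum]

theorem rTensor_comul_one' (h : WBA) :
    (comul (R := K)).rTensor A Δ₁ = (mulRight K Δ₁ ∘ₗ incr K A).rTensor A Δ₁ := by
  rw [h.weak_comul_unit_b, ← (ℛ K (1 : A)).eq]
  simp [Finset.sum_mul, Finset.mul_sum, TensorProduct.sum_tmul, TensorProduct.tmul_sum]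
  rw [Finset.sum_comm]

theorem piL_eq_slice (x : A) :
    πL x = TensorProduct.lid K A ((counit (R := K) ∘ₗ mulRight K x).rTensor A Δ₁) := by
  rw [piL_repr (ℛ K (1 : A)), ← (ℛ K (1 : A)).eq]
  simp

theorem piR_eq_slice (x : A) :
    πR x = TensorProduct.rid K A ((counit (R := K) ∘ₗ mulLeft K x).lTensor A Δ₁) := by
  rw [piR_repr (ℛ K (1 : A)), ← (ℛ K (1 : A)).eq]
  simp

theorem comul_one_mul (h : WBA) (x : A) : Δ₁ * comul (R := K) x = comul x := by
  rw [← h.comul_mul, one_mul]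

theorem comul_mul_one (h : WBA) (x : A) : comul (R := K) x * Δ₁ = comul x := by
  rw [← h.comul_mul, mul_one]

theorem comul_piL (h : WBA) (x : A) : comul (R := K) (πL x) = (πL x ⊗ₜ 1) * Δ₁ := by
  rw [piL_eq_slice, ← lid_rTensor_lTensor, lTensor_comul_one h, lid_rTensor_lTensor]
  rfl

theorem comul_piL' (h : WBA) (x : A) : comul (R := K) (πL x) = Δ₁ * (πL x ⊗ₜ 1) := by
  rw [piL_eq_slice, ← lid_rTensor_lTensor, lTensor_comul_one' h, lid_rTensor_lTensor]
  rfl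

theorem comul_piR (h : WBA) (x : A) : comul (R := K) (πR x) = Δ₁ * (1 ⊗ₜ πR x) := by
  rw [piR_eq_slice, ← rid_lTensor_rTensor, rTensor_comul_one h, rid_lTensor_rTensor]
  rfl

theorem comul_piR' (h : WBA) (x : A) : comul (R := K) (πR x) = (1 ⊗ₜ πR x) * Δ₁ := by
  rw [piR_eq_slice, ← rid_lTensor_rTensor, rTensor_comul_one' h, rid_lTensor_rTensor]
  rfl

theorem comul_piL_mul (h : WBA) (x y : A) :
    comul (R := K) (πL x * y) = (πL x ⊗ₜ 1) * comul y := by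
  rw [h.comul_mul, comul_piL h, mul_assoc, comul_one_mul h]

theorem comul_mul_piL (h : WBA) (x y : A) :
    comul (R := K) (y * πL x) = comul y * (πL x ⊗ₜ 1) := by
  rw [h.comul_mul, comul_piL' h, ← mul_assoc, comul_mul_one h]

theorem comul_piR_mul (h : WBA) (x y : A) :
    comul (R := K) (πR x * y) = (1 ⊗ₜ πR x) * comul y := by
  rw [h.comul_mul, comul_piR' h, mul_assoc, comul_one_mul h]

theorem piL_mul_piR_comm (h : WBA) (x y : A) : πL x * πR y = πR y * πL x := by
  have key := congrArg
    (TensorProduct.rid K A ∘ (counit (R := K) ∘ₗ mulLeft K y).lTensor A)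
    ((comul_piL h x).symm.trans (comul_piL' h x))
  have h1 : ∀ t : A ⊗[K] A, TensorProduct.rid K A
      ((counit (R := K) ∘ₗ mulLeft K y).lTensor A ((πL x ⊗ₜ 1) * t)) =
      πL x * TensorProduct.rid K A ((counit (R := K) ∘ₗ mulLeft K y).lTensor A t) := by
    intro t
    induction t with
    | zero => simp
    | tmul => simp
    | add _ _ h₁ h₂ => simp only [map_add, mul_add, h₁, h₂]
  have h2 : ∀ t : A ⊗[K] A, TensorProduct.rid K A
      ((counit (R := K) ∘ₗ mulLeft K y).lTensor A (t * (πL x ⊗ₜ 1))) =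
      TensorProduct.rid K A ((counit (R := K) ∘ₗ mulLeft K y).lTensor A t) * πL x := by
    intro t
    induction t with
    | zero => simp
    | tmul => simp
    | add _ _ h₁ h₂ => simp only [map_add, add_mul, h₁, h₂]
  simpa only [Function.comp_apply, h1, h2, ← piR_eq_slice] using key

theorem incl_piR_conv_incr (h : WBA) :
    (incl K A ∘ₗ πR) ⋆ (incr K A) = mulRight K Δ₁ ∘ₗ incr K A := by
  rw [← comp_id (incr K A), incl_conv_incr]
  ext x
  have key := congrArg (((TensorProduct.lid K A).toLinearMap ∘ₗ (counit (R := K)).rTensor A ∘ₗ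
    mulLeft K (comul x)).lTensor A) (lTensor_comul_one' h)
  rw [← lTensor_comp_apply, ← lTensor_comp_apply] at key
  have e1 : ((TensorProduct.lid K A).toLinearMap ∘ₗ (counit (R := K)).rTensor A ∘ₗ
      mulLeft K (comul x)) ∘ₗ comul = mulLeft K x := by
    ext y
    simp only [comp_apply, mulLeft_apply, ← h.comul_mul]
    exact h.counit_left _
  have e2 : ((TensorProduct.lid K A).toLinearMap ∘ₗ (counit (R := K)).rTensor A ∘ₗ
      mulLeft K (comul x)) ∘ₗ mulLeft K Δ₁ ∘ₗ incl K A =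
      (TensorProduct.lid K A).toLinearMap ∘ₗ (counit (R := K)).rTensor A ∘ₗ
      mulLeft K (comul x) ∘ₗ incl K A := by
    ext y
    simp only [comp_apply, mulLeft_apply, ← mul_assoc, comul_mul_one h]
  rw [e1, e2] at key
  have e3 : (1 ⊗ₜ[K] x) * Δ₁ = (mulLeft K x).lTensor A Δ₁ := by
    rw [← (ℛ K (1 : A)).eq]
    simp [Finset.mul_sum]
  simp only [comp_apply, mulRight_apply, incr_apply, id_apply]
  rw [e3, key, ← (ℛ K x).eq, ← (ℛ K (1 : A)).eq]
  simp [piR_repr (ℛ K (1 : A)), Finset.sum_mul, TensorProduct.sum_tmul, TensorProduct.tmul_sum,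
    TensorProduct.smul_tmul]
  rw [Finset.sum_comm]

theorem incl_conv_incr_piL (h : WBA) :
    (incl K A) ⋆ (incr K A ∘ₗ πL) = mulLeft K Δ₁ ∘ₗ incl K A := by
  rw [← comp_id (incl K A), incl_conv_incr]
  ext x
  have key := congrArg (((TensorProduct.rid K A).toLinearMap ∘ₗ (counit (R := K)).lTensor A ∘ₗ
    mulRight K (comul x)).rTensor A) (rTensor_comul_one' h)
  rw [← rTensor_comp_apply, ← rTensor_comp_apply] at key
  have e1 : ((TensorProduct.rid K A).toLinearMap ∘ₗ (counit (R := K)).lTensor A ∘ₗ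
      mulRight K (comul x)) ∘ₗ comul = mulRight K x := by
    ext y
    simp only [comp_apply, mulRight_apply, ← h.comul_mul]
    exact h.counit_right _
  have e2 : ((TensorProduct.rid K A).toLinearMap ∘ₗ (counit (R := K)).lTensor A ∘ₗ
      mulRight K (comul x)) ∘ₗ mulRight K Δ₁ ∘ₗ incr K A =
      (TensorProduct.rid K A).toLinearMap ∘ₗ (counit (R := K)).lTensor A ∘ₗ
      mulRight K (comul x) ∘ₗ incr K A := by
    ext y
    simp only [comp_apply, mulRight_apply, mul_assoc, comul_one_mul h]
  rw [e1, e2] at key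
  have e3 : Δ₁ * (x ⊗ₜ[K] 1) = (mulRight K x).rTensor A Δ₁ := by
    rw [← (ℛ K (1 : A)).eq]
    simp [Finset.sum_mul]
  simp only [comp_apply, mulLeft_apply, incl_apply, id_apply]
  rw [e3, key, ← (ℛ K x).eq, ← (ℛ K (1 : A)).eq]
  simp [piL_repr (ℛ K (1 : A)), Finset.mul_sum, TensorProduct.sum_tmul, TensorProduct.tmul_sum,
    TensorProduct.smul_tmul]
  rw [Finset.sum_comm]

theorem lTensor_piL_comul_one (h : WBA) : (πL).lTensor A Δ₁ = Δ₁ := by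
  have := congrArg (· (1 : A)) (incl_conv_incr_piL h)
  rw [← comp_id (incl K A), incl_conv_incr] at this
  simpa [lTensor, ← Algebra.TensorProduct.one_def] using this

theorem rTensor_piR_comul_one (h : WBA) : (πR).rTensor A Δ₁ = Δ₁ := by
  have := congrArg (· (1 : A)) (incl_piR_conv_incr h)
  rw [← comp_id (incr K A), incl_conv_incr] at this
  simpa [rTensor, ← Algebra.TensorProduct.one_def] using this

theorem piL_conv_id (h : WBA) : πL ⋆ LinearMap.id = LinearMap.id := by
  ext x
  conv_rhs => rw [id_apply, ← h.counit_left x, ← comul_one_mul h]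
  rw [conv_repr _ _ (ℛ K x), ← (ℛ K x).eq, ← (ℛ K (1 : A)).eq]
  simp [piL_repr (ℛ K (1 : A)), Finset.sum_mul, Finset.mul_sum]

theorem id_conv_piR (h : WBA) : LinearMap.id ⋆ πR = LinearMap.id := by
  ext x
  conv_rhs => rw [id_apply, ← h.counit_right x, ← comul_mul_one h]
  rw [conv_repr _ _ (ℛ K x), ← (ℛ K x).eq, ← (ℛ K (1 : A)).eq]
  simp [piR_repr (ℛ K (1 : A)), Finset.sum_mul, Finset.mul_sum]
  rw [Finset.sum_comm]

theorem counit_piR_mul (h : WBA) (x y : A) :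
    counit (R := K) (πR x * y) = counit (R := K) (x * y) := by
  have := h.weak_counit_b x 1 y
  rw [mul_one] at this
  rw [this, piR_repr (ℛ K (1 : A)), ← (ℛ K (1 : A)).eq]
  simp [Finset.sum_mul, mul_comm]

theorem counit_mul_piL (h : WBA) (x y : A) :
    counit (R := K) (x * πL y) = counit (R := K) (x * y) := by
  have := h.weak_counit_b x 1 y
  rw [mul_one] at this
  rw [this, piL_repr (ℛ K (1 : A)), ← (ℛ K (1 : A)).eq]
  simp [Finset.mul_sum]

theorem piR_piR_mul (h : WBA) (x y : A) : πR (πR x * y) = πR (x * y) := by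
  simp only [piR_repr (ℛ K (1 : A)), mul_assoc]
  simp only [← piR_repr (ℛ K (1 : A)), counit_piR_mul h]

theorem piL_mul_piL (h : WBA) (x y : A) : πL (x * πL y) = πL (x * y) := by
  simp only [piL_repr (ℛ K (1 : A)), ← mul_assoc]
  simp only [← piL_repr (ℛ K (1 : A)), counit_mul_piL h]

theorem counit_piL (h : WBA) (x : A) : counit (R := K) (πL x) = counit (R := K) x := by
  simpa using counit_mul_piL h 1 x

theorem counit_piR (h : WBA) (x : A) : counit (R := K) (πR x) = counit (R := K) x := by
  simpa using counit_piR_mul h x 1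

theorem piL_one (h : WBA) : πL (1 : A) = 1 := by
  rw [piL_apply, ← Algebra.TensorProduct.one_def, mul_one, h.counit_left]

theorem piR_one (h : WBA) : πR (1 : A) = 1 := by
  rw [piR_apply, ← Algebra.TensorProduct.one_def, one_mul, h.counit_right]

theorem map_piR_piL_comm_comul_one (h : WBA) :
    TensorProduct.map πR πL (TensorProduct.comm K A A Δ₁) = Δ₁ := by
  conv_rhs => rw [← lTensor_piL_comul_one h]
  have key : ∀ x z : A, ∑ i ∈ (ℛ K (1 : A)).index, counit (R := K) ((ℛ K (1 : A)).right i * z) *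
      counit (R := K) (x * (ℛ K (1 : A)).left i) = counit (R := K) (x * z) := by
    intro x z
    have := h.weak_counit_a x 1 z
    rw [mul_one, ← (ℛ K (1 : A)).eq] at this
    rw [this]
    simp [mul_comm]
  rw [← (ℛ K (1 : A)).eq]
  simp only [map_sum, TensorProduct.comm_tmul, TensorProduct.map_tmul, lTensor_tmul,
    piR_repr (ℛ K (1 : A)), piL_repr (ℛ K (1 : A)), TensorProduct.sum_tmul,
    TensorProduct.tmul_sum, TensorProduct.smul_tmul', TensorProduct.tmul_smul, Finset.smul_sum,
    smul_smul]
  rw [Finset.sum_comm]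
  conv_rhs => rw [Finset.sum_comm]
  refine Finset.sum_congr rfl fun k _ => ?_
  rw [Finset.sum_comm]
  refine Finset.sum_congr rfl fun j _ => ?_
  rw [← key, Finset.sum_smul, TensorProduct.sum_tmul]
  refine Finset.sum_congr rfl fun i _ => ?_
  congr 2
  exact mul_comm _ _

section Antipode

variable {S : A →ₗ[K] A}

local notation "WHA" => WeakHopfAlgebra K A (comul (R := K) (A := A)) (counit (R := K) (A := A))

theorem id_conv_antipode (hS : WHA S) : LinearMap.id ⋆ S = πL :=
  LinearMap.ext hS.antipode_a

theorem antipode_conv_id (hS : WHA S) : S ⋆ LinearMap.id = πR :=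
  LinearMap.ext hS.antipode_b

theorem antipode_conv_piL (hS : WHA S) : S ⋆ πL = S := by
  rw [← id_conv_antipode hS]
  ext x
  conv_rhs => rw [← hS.antipode_c x]
  rw [conv_repr _ _ (ℛ K x), ← (ℛ K x).eq]
  simp [conv_apply, lTensor]

theorem piR_conv_antipode (hS : WHA S) : πR ⋆ S = S := by
  rw [← antipode_conv_id hS, conv_assoc, id_conv_antipode hS, antipode_conv_piL hS]

theorem antipode_piL (hS : WHA S) (x : A) : S (πL x) = πR (πL x) := by
  have h := hS.toWeakBialgebra
  have e : ∀ t : A ⊗[K] A, mul' K A (TensorProduct.map S πL (t * (πL x ⊗ₜ 1))) =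
      mul' K A (TensorProduct.map S LinearMap.id ((πL).lTensor A t * (πL x ⊗ₜ 1))) := by
    intro t
    induction t with
    | zero => simp
    | tmul => simp
    | add _ _ h₁ h₂ => simp only [map_add, add_mul, h₁, h₂]
  conv_lhs => rw [← antipode_conv_piL hS]
  rw [← antipode_conv_id hS, conv_apply, conv_apply, comul_piL' h, e,
    lTensor_piL_comul_one h]

theorem antipode_piR (hS : WHA S) (x : A) : S (πR x) = πL (πR x) := by
  have h := hS.toWeakBialgebra
  have e : ∀ t : A ⊗[K] A, mul' K A (TensorProduct.map πR S ((1 ⊗ₜ πR x) * t)) =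
      mul' K A (TensorProduct.map LinearMap.id S ((1 ⊗ₜ πR x) * (πR).rTensor A t)) := by
    intro t
    induction t with
    | zero => simp
    | tmul => simp
    | add _ _ h₁ h₂ => simp only [map_add, mul_add, h₁, h₂]
  conv_lhs => rw [← piR_conv_antipode hS]
  rw [← id_conv_antipode hS, conv_apply, conv_apply, comul_piR' h, e,
    rTensor_piR_comul_one h]

theorem antipode_one (hS : WHA S) : S 1 = 1 := by
  have := antipode_piL hS 1
  rwa [piL_one hS.1, piR_one hS.1] at this

theorem map_antipode_comm_comul_one (hS : WHA S) :
    TensorProduct.map S S (TensorProduct.comm K A A Δ₁) = Δ₁ := by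
  have h := hS.toWeakBialgebra
  have e : ∀ t : A ⊗[K] A, TensorProduct.map S S
      (TensorProduct.comm K A A ((πL).lTensor A ((πR).rTensor A t))) =
      TensorProduct.map πR πL
        (TensorProduct.comm K A A ((πL).lTensor A ((πR).rTensor A t))) := by
    intro t
    induction t with
    | zero => simp
    | tmul => simp [antipode_piL hS, antipode_piR hS]
    | add _ _ h₁ h₂ => simp only [map_add, h₁, h₂]
  have := e Δ₁
  rwa [rTensor_piR_comul_one h, lTensor_piL_comul_one h, map_piR_piL_comm_comul_one h] at this

section Antimultiplicative

variable (K A) in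
/-- The coalgebra projection `x ⊗ y ↦ ε(y) x`. -/
def proj₁ : A ⊗[K] A →ₗ[K] A := (TensorProduct.rid K A).toLinearMap ∘ₗ (counit (R := K)).lTensor A

variable (K A) in
/-- The coalgebra projection `x ⊗ y ↦ ε(x) y`. -/
def proj₂ : A ⊗[K] A →ₗ[K] A := (TensorProduct.lid K A).toLinearMap ∘ₗ (counit (R := K)).rTensor A

@[simp] theorem proj₁_tmul (x y : A) : proj₁ K A (x ⊗ₜ y) = counit (R := K) y • x := by
  simp [proj₁]

@[simp] theorem proj₂_tmul (x y : A) : proj₂ K A (x ⊗ₜ y) = counit (R := K) x • y := by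
  simp [proj₂]

theorem comul_tmul_repr (x y : A) : comul (R := K) (x ⊗ₜ[K] y) =
    ∑ i ∈ (ℛ K x).index, ∑ j ∈ (ℛ K y).index,
      ((ℛ K x).left i ⊗ₜ (ℛ K y).left j) ⊗ₜ[K] ((ℛ K x).right i ⊗ₜ (ℛ K y).right j) := by
  rw [TensorProduct.comul_tmul, ← (ℛ K x).eq, ← (ℛ K y).eq]
  simp [TensorProduct.sum_tmul, TensorProduct.tmul_sum]
  rw [Finset.sum_comm]

theorem conv_tmul {B : Type*} [Ring B] [Algebra K B] (f g : A ⊗[K] A →ₗ[K] B) (x y : A) :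
    (f ⋆ g) (x ⊗ₜ y) = ∑ i ∈ (ℛ K x).index, ∑ j ∈ (ℛ K y).index,
      f ((ℛ K x).left i ⊗ₜ (ℛ K y).left j) * g ((ℛ K x).right i ⊗ₜ (ℛ K y).right j) := by
  rw [conv_apply, comul_tmul_repr]
  simp

theorem sum_counit_left (x : A) :
    ∑ i ∈ (ℛ K x).index, counit (R := K) ((ℛ K x).left i) • (ℛ K x).right i = x :=
  sum_counit_smul _

theorem sum_counit_right (x : A) :
    ∑ i ∈ (ℛ K x).index, counit (R := K) ((ℛ K x).right i) • (ℛ K x).left i = x := by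
  have := congrArg (TensorProduct.rid K A) (sum_tmul_counit_eq (ℛ K x))
  simpa only [map_sum, TensorProduct.rid_tmul, one_smul] using this

theorem comul_mul' (h : WBA) (d : A ⊗[K] A) :
    comul (R := K) (mul' K A d) = TensorProduct.map (mul' K A) (mul' K A) (comul d) := by
  induction d with
  | zero => simp
  | add _ _ h₁ h₂ => simp only [map_add, h₁, h₂]
  | tmul x y =>
    rw [comul_tmul_repr, mul'_apply, h.comul_mul, ← (ℛ K x).eq, ← (ℛ K y).eq]
    simp [Finset.sum_mul_sum]

theorem proj₂_comp_conv_apply (f : A →ₗ[K] A) (F : A ⊗[K] A →ₗ[K] A) (x y : A) :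
    ((f ∘ₗ proj₂ K A) ⋆ F) (x ⊗ₜ y) =
      mul' K A (TensorProduct.map f (F ∘ₗ TensorProduct.mk K A A x) (comul y)) := by
  rw [conv_tmul, ← (ℛ K y).eq, Finset.sum_comm]
  conv_rhs => rw [← sum_counit_left (K := K) x]
  simp [Finset.mul_sum]

theorem conv_comp_proj₁_apply (f : A →ₗ[K] A) (F : A ⊗[K] A →ₗ[K] A) (x y : A) :
    (F ⋆ (f ∘ₗ proj₁ K A)) (x ⊗ₜ y) =
      mul' K A (TensorProduct.map (F ∘ₗ (TensorProduct.mk K A A).flip y) f (comul x)) := by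
  rw [conv_tmul, ← (ℛ K x).eq]
  conv_rhs => rw [← sum_counit_right (K := K) y]
  simp [Finset.sum_mul]

theorem proj₁_conv_proj₂_apply (f g : A →ₗ[K] A) (x y : A) :
    ((f ∘ₗ proj₁ K A) ⋆ (g ∘ₗ proj₂ K A)) (x ⊗ₜ y) = f x * g y := by
  rw [conv_tmul]
  conv_rhs => rw [← sum_counit_right (K := K) x, ← sum_counit_left (K := K) y]
  simp [Finset.sum_mul_sum]
  exact Finset.sum_congr rfl fun _ _ => Finset.sum_congr rfl fun _ _ => smul_comm _ _ _

theorem proj₂_conv_proj₁_apply (f g : A →ₗ[K] A) (x y : A) :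
    ((f ∘ₗ proj₂ K A) ⋆ (g ∘ₗ proj₁ K A)) (x ⊗ₜ y) = f y * g x := by
  rw [conv_tmul, Finset.sum_comm]
  conv_rhs => rw [← sum_counit_left (K := K) x, ← sum_counit_right (K := K) y]
  simp [Finset.sum_mul_sum]
  exact Finset.sum_congr rfl fun _ _ => Finset.sum_congr rfl fun _ _ => smul_comm _ _ _

theorem comul_proj₁ (d : A ⊗[K] A) :
    comul (R := K) (proj₁ K A d) = TensorProduct.map (proj₁ K A) (proj₁ K A) (comul d) := by
  induction d with
  | zero => simp
  | add _ _ h₁ h₂ => simp only [map_add, h₁, h₂]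
  | tmul x y =>
    have := congrArg (counit (R := K)) (sum_counit_left (K := K) y)
    rw [comul_tmul_repr, proj₁_tmul, map_smul, ← this, ← (ℛ K x).eq]
    simp [Finset.sum_smul, Finset.smul_sum, TensorProduct.smul_tmul', TensorProduct.tmul_smul,
      smul_smul, mul_comm]

theorem comul_proj₂ (d : A ⊗[K] A) :
    comul (R := K) (proj₂ K A d) = TensorProduct.map (proj₂ K A) (proj₂ K A) (comul d) := by
  induction d with
  | zero => simp
  | add _ _ h₁ h₂ => simp only [map_add, h₁, h₂]
  | tmul x y =>
    have := congrArg (counit (R := K)) (sum_counit_left (K := K) x)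
    rw [comul_tmul_repr, proj₂_tmul, map_smul, ← this, ← (ℛ K y).eq]
    simp [Finset.sum_smul, Finset.smul_sum, TensorProduct.smul_tmul', TensorProduct.tmul_smul,
      smul_smul, mul_comm]
    rw [Finset.sum_comm]

theorem mul'_eq_conv :
    mul' K A = (LinearMap.id ∘ₗ proj₁ K A) ⋆ (LinearMap.id ∘ₗ proj₂ K A) := by
  ext x y
  exact (proj₁_conv_proj₂_apply LinearMap.id LinearMap.id x y).symm

theorem antipode_mul (hS : WHA S) (x y : A) : S (x * y) = S y * S x := by
  have h := hS.toWeakBialgebra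
  let p := proj₁ K A
  let q := proj₂ K A
  have hp (f g : A →ₗ[K] A) : (f ∘ₗ p) ⋆ (g ∘ₗ p) = (f ⋆ g) ∘ₗ p :=
    (conv_comp_of_comul p comul_proj₁ f g).symm
  have hq (f g : A →ₗ[K] A) : (f ∘ₗ q) ⋆ (g ∘ₗ q) = (f ⋆ g) ∘ₗ q :=
    (conv_comp_of_comul q comul_proj₂ f g).symm
  have hm (f g : A →ₗ[K] A) : (f ∘ₗ mul' K A) ⋆ (g ∘ₗ mul' K A) = (f ⋆ g) ∘ₗ mul' K A :=
    (conv_comp_of_comul (mul' K A) (comul_mul' h) f g).symm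
  have hm' : mul' K A = LinearMap.id ∘ₗ mul' K A := rfl
  have key : S ∘ₗ mul' K A = (S ∘ₗ q) ⋆ (S ∘ₗ p) := by
    have h1 : (S ∘ₗ q) ⋆ (S ∘ₗ p) ⋆ mul' K A = (S ∘ₗ q) ⋆ ((πR ∘ₗ p) ⋆ (LinearMap.id ∘ₗ q)) := by
      rw [mul'_eq_conv, conv_assoc, ← conv_assoc (S ∘ₗ p), hp, antipode_conv_id hS]
    have h2 : mul' K A ⋆ ((S ∘ₗ q) ⋆ (S ∘ₗ p)) = (LinearMap.id ∘ₗ p) ⋆ (πL ∘ₗ q) ⋆ (S ∘ₗ p) := by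
      rw [mul'_eq_conv, conv_assoc, ← conv_assoc _ (S ∘ₗ q), hq, id_conv_antipode hS, conv_assoc]
    have h3 : (πR ∘ₗ p) ⋆ (πL ∘ₗ q) = (πL ∘ₗ q) ⋆ (πR ∘ₗ p) := by
      refine TensorProduct.ext' fun x y => ?_
      rw [proj₁_conv_proj₂_apply, proj₂_conv_proj₁_apply, piL_mul_piR_comm h]
    refine conv_inverse_unique (m := mul' K A) (p := πR ∘ₗ mul' K A) (q := πL ∘ₗ mul' K A)
      ?_ ?_ ?_ ?_ ?_ ?_
    · conv_lhs => rw [hm']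
      rw [← comp_assoc, comp_id, hm, antipode_conv_id hS]
    · conv_lhs => rw [hm']
      rw [← comp_assoc, comp_id, hm, id_conv_antipode hS]
    · have : S ∘ₗ mul' K A ⋆ mul' K A = πR ∘ₗ mul' K A := by
        conv_lhs => rw [hm']
        rw [← comp_assoc, comp_id, hm, antipode_conv_id hS]
      rw [this, hm, piR_conv_antipode hS]
    · rw [h1]
      refine TensorProduct.ext' fun x y => ?_
      rw [proj₂_comp_conv_apply]
      have e : ((πR ∘ₗ p) ⋆ (LinearMap.id ∘ₗ q)) ∘ₗ TensorProduct.mk K A A x =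
          mulLeft K (πR x) := by
        ext z
        exact proj₁_conv_proj₂_apply _ _ _ _
      have e' : TensorProduct.map S (mulLeft K (πR x)) (comul (R := K) y) =
          TensorProduct.map S LinearMap.id (comul (R := K) (πR x * y)) := by
        rw [comul_piR_mul h, ← (ℛ K y).eq]
        simp [Finset.mul_sum]
      rw [e, e', ← conv_apply, antipode_conv_id hS, piR_piR_mul h]
      rfl
    · rw [h2]
      refine TensorProduct.ext' fun x y => ?_
      rw [conv_comp_proj₁_apply]
      have e : ((LinearMap.id ∘ₗ p) ⋆ (πL ∘ₗ q)) ∘ₗ (TensorProduct.mk K A A).flip y =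
          mulRight K (πL y) := by
        ext z
        exact proj₁_conv_proj₂_apply _ _ _ _
      have e' : TensorProduct.map (mulRight K (πL y)) S (comul (R := K) x) =
          TensorProduct.map LinearMap.id S (comul (R := K) (x * πL y)) := by
        rw [comul_mul_piL h, ← (ℛ K x).eq]
        simp [Finset.sum_mul]
      rw [e, e', ← conv_apply, id_conv_antipode hS, piL_mul_piL h]
      rfl
    · rw [h1, conv_assoc, conv_assoc, ← conv_assoc _ (S ∘ₗ q), hq, id_conv_antipode hS,
        ← conv_assoc (πR ∘ₗ p), h3, conv_assoc, hp, piR_conv_antipode hS, ← conv_assoc, hq,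
        antipode_conv_piL hS]
  have := congrArg (· (x ⊗ₜ[K] y)) key
  simpa [proj₂_conv_proj₁_apply, p, q] using this

end Antimultiplicative

theorem map_antipode_comm_comul (S : A →ₗ[K] A) (x : A) :
    TensorProduct.map S S (TensorProduct.comm K A A (comul x)) =
      (((incr K A ∘ₗ S) ⋆ (incl K A ∘ₗ S)) x : A ⊗[K] A) := by
  rw [conv_repr _ _ (ℛ K x), ← (ℛ K x).eq]
  simp

theorem map_antipode_comm_mul (hS : WHA S) (s t : A ⊗[K] A) :
    TensorProduct.map S S (TensorProduct.comm K A A (s * t)) =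
      TensorProduct.map S S (TensorProduct.comm K A A t) *
        TensorProduct.map S S (TensorProduct.comm K A A s) := by
  induction s with
  | zero => simp
  | add _ _ h₁ h₂ => simp only [map_add, add_mul, mul_add, h₁, h₂]
  | tmul a b =>
    induction t with
    | zero => simp
    | add _ _ h₁ h₂ => simp only [map_add, add_mul, mul_add, h₁, h₂]
    | tmul c d => simp [antipode_mul hS]

theorem comul_eq_incl_conv_incr : (comul : A →ₗ[K] A ⊗[K] A) = incl K A ⋆ incr K A := by
  rw [← comp_id (incl K A), ← comp_id (incr K A), incl_conv_incr, TensorProduct.map_id, id_comp]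

theorem comul_comp_conv_comul_comp (h : WBA) (f g : A →ₗ[K] A) :
    (comul ∘ₗ f) ⋆ (comul ∘ₗ g) = (comul : A →ₗ[K] A ⊗[K] A) ∘ₗ (f ⋆ g) :=
  (comp_conv_of_map_mul _ h.comul_mul f g).symm

theorem comul_antipode_conv_comul (hS : WHA S) :
    (comul ∘ₗ S) ⋆ comul = (comul : A →ₗ[K] A ⊗[K] A) ∘ₗ πR := by
  rw [← antipode_conv_id hS, ← comul_comp_conv_comul_comp hS.1, comp_id]

theorem comul_conv_comul_antipode (hS : WHA S) :
    comul ⋆ (comul ∘ₗ S) = (comul : A →ₗ[K] A ⊗[K] A) ∘ₗ πL := by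
  rw [← id_conv_antipode hS, ← comul_comp_conv_comul_comp hS.1, comp_id]

theorem incr_antipode_conv_incl_antipode_conv_comul (hS : WHA S) :
    (incr K A ∘ₗ S) ⋆ (incl K A ∘ₗ S) ⋆ comul = comul ∘ₗ πR := by
  have e : mulRight K Δ₁ ∘ₗ (incr K A ∘ₗ πR) = comul ∘ₗ πR :=
    LinearMap.ext fun x => (comul_piR' hS.1 x).symm
  have e₁ : (incl K A ∘ₗ S) ⋆ incl K A = incl K A ∘ₗ πR := by
    rw [← antipode_conv_id hS, incl_conv, comp_id]
  have e₂ : (incr K A ∘ₗ S) ⋆ incr K A = incr K A ∘ₗ πR := by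
    rw [← antipode_conv_id hS, incr_conv, comp_id]
  rw [← e, comul_eq_incl_conv_incr, conv_assoc, ← conv_assoc (incl K A ∘ₗ S)]
  rw [← comul_eq_incl_conv_incr, e₁, incl_piR_conv_incr hS.1, ← mulRight_comp_conv, e₂]

theorem comul_conv_incr_antipode_conv_incl_antipode (hS : WHA S) :
    comul ⋆ ((incr K A ∘ₗ S) ⋆ (incl K A ∘ₗ S)) = comul ∘ₗ πL := by
  have e : mulLeft K Δ₁ ∘ₗ (incl K A ∘ₗ πL) = comul ∘ₗ πL :=
    LinearMap.ext fun x => (comul_piL' hS.1 x).symm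
  have e₁ : incr K A ⋆ (incr K A ∘ₗ S) = incr K A ∘ₗ πL := by
    rw [← id_conv_antipode hS, incr_conv, comp_id]
  have e₂ : incl K A ⋆ (incl K A ∘ₗ S) = incl K A ∘ₗ πL := by
    rw [← id_conv_antipode hS, incl_conv, comp_id]
  rw [← e, comul_eq_incl_conv_incr, conv_assoc, ← conv_assoc (incr K A)]
  rw [← comul_eq_incl_conv_incr, e₁, ← conv_assoc, incl_conv_incr_piL hS.1, ← mulLeft_comp_conv, e₂]

theorem comul_comp_antipode (hS : WHA S) :
    comul ∘ₗ S = (incr K A ∘ₗ S) ⋆ (incl K A ∘ₗ S) := by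
  refine conv_inverse_unique (comul_antipode_conv_comul hS) (comul_conv_comul_antipode hS) ?_
    (incr_antipode_conv_incl_antipode_conv_comul hS)
    (comul_conv_incr_antipode_conv_incl_antipode hS) ?_
  · rw [comul_antipode_conv_comul hS, comul_comp_conv_comul_comp hS.1, piR_conv_antipode hS]
  · have e : comul ∘ₗ πR = mulLeft K Δ₁ ∘ₗ (incr K A ∘ₗ πR) :=
      LinearMap.ext fun x => comul_piR hS.1 x
    have e₁ : (incr K A ∘ₗ πR) ⋆ (incr K A ∘ₗ S) = incr K A ∘ₗ S := by
      rw [← incr_conv, piR_conv_antipode hS]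
    rw [incr_antipode_conv_incl_antipode_conv_comul hS, e, ← mulLeft_comp_conv, ← conv_assoc, e₁]
    ext x : 1
    rw [comp_apply, mulLeft_apply, ← map_antipode_comm_comul S]
    conv_lhs => rw [← map_antipode_comm_comul_one hS]
    rw [← map_antipode_comm_mul hS, comul_mul_one hS.1]

theorem comul_antipode (hS : WHA S) (x : A) : comul (R := K) (S x) =
    TensorProduct.map S S (TensorProduct.comm K A A (comul x)) := by
  rw [map_antipode_comm_comul S, ← comul_comp_antipode hS, comp_apply]

theorem antipode_piL_eq_piR_antipode (hS : WHA S) (x : A) : S (πL x) = πR (S x) := by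
  rw [← id_conv_antipode hS, ← antipode_conv_id hS, conv_apply (C := A) S, comul_antipode hS,
    conv_repr _ _ (ℛ K x), ← (ℛ K x).eq]
  simp [antipode_mul hS]

theorem counit_antipode (hS : WHA S) (x : A) : counit (R := K) (S x) = counit (R := K) x := by
  have h := hS.toWeakBialgebra
  rw [← counit_piR h (S x), ← antipode_piL_eq_piR_antipode hS, antipode_piL hS, counit_piR h,
    counit_piL h]

section Bijective

/-- A unital subalgebra (given as a subspace) which is also a subcoalgebra. -/
structure IsSubbialgebra (C : Submodule K A) : Prop where
  one_mem : 1 ∈ C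
  mul_mem : ∀ a ∈ C, ∀ b ∈ C, a * b ∈ C
  comul_mem : ∀ a ∈ C, comul (R := K) a ∈ range (TensorProduct.mapIncl C C)

theorem IsSubbialgebra.top : IsSubbialgebra (⊤ : Submodule K A) where
  one_mem := trivial
  mul_mem _ _ _ _ := trivial
  comul_mem a _ := by
    rw [← (ℛ K a).eq]
    exact sum_mem fun i _ => ⟨⟨(ℛ K a).left i, trivial⟩ ⊗ₜ ⟨(ℛ K a).right i, trivial⟩, rfl⟩

theorem IsSubbialgebra.piL_mem {C : Submodule K A} (hC : IsSubbialgebra C) (x : A) :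
    πL x ∈ C := by
  rw [piL_eq_slice]
  refine apply_mem_of_mem_range_mapIncl (f := (TensorProduct.lid K A).toLinearMap ∘ₗ
    (counit (R := K) ∘ₗ mulRight K x).rTensor A) (fun a _ b hb => ?_) (hC.comul_mem 1 hC.one_mem)
  simpa using C.smul_mem _ hb

theorem IsSubbialgebra.piR_mem {C : Submodule K A} (hC : IsSubbialgebra C) (x : A) :
    πR x ∈ C := by
  rw [piR_eq_slice]
  refine apply_mem_of_mem_range_mapIncl (f := (TensorProduct.rid K A).toLinearMap ∘ₗ
    (counit (R := K) ∘ₗ mulLeft K x).lTensor A) (fun a ha b _ => ?_) (hC.comul_mem 1 hC.one_mem)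
  simpa using C.smul_mem _ ha

theorem IsSubbialgebra.map_antipode (hS : WHA S) {C : Submodule K A} (hC : IsSubbialgebra C) :
    IsSubbialgebra (C.map S) where
  one_mem := ⟨1, hC.one_mem, antipode_one hS⟩
  mul_mem := by
    rintro _ ⟨a, ha, rfl⟩ _ ⟨b, hb, rfl⟩
    exact ⟨b * a, hC.mul_mem b hb a ha, antipode_mul hS b a⟩
  comul_mem := by
    rintro _ ⟨a, ha, rfl⟩
    rw [comul_antipode hS]
    refine apply_mem_of_mem_range_mapIncl (f := TensorProduct.map S S ∘ₗ
      (TensorProduct.comm K A A).toLinearMap) (fun a ha b hb => ?_) (hC.comul_mem a ha)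
    exact ⟨⟨S b, b, hb, rfl⟩ ⊗ₜ ⟨S a, a, ha, rfl⟩, rfl⟩

theorem IsSubbialgebra.le_map_antipode [FiniteDimensional K A] (hS : WHA S) {C : Submodule K A}
    (hC : IsSubbialgebra C) (hle : C.map S ≤ C) (hmap : (C.map S).map S = C.map S) :
    C ≤ C.map S := by
  have hD := hC.map_antipode hS
  have hSC : ∀ a ∈ C, S a ∈ C.map S := fun a ha => ⟨a, ha, rfl⟩
  set D := C.map S with hDdef
  have hSD : ∀ d ∈ D, S d ∈ D := fun d hd => hSC d (hle hd)
  have hsurj : Function.Surjective (S.restrict hSD) := by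
    rintro ⟨d, hd⟩
    rw [← hmap] at hd
    obtain ⟨e, he, rfl⟩ := hd
    exact ⟨⟨e, he⟩, rfl⟩
  have hinj := LinearMap.injective_iff_surjective.2 hsurj
  have hinj' : ∀ d ∈ D, ∀ e ∈ D, S d = S e → d = e := fun d hd e he hde =>
    congrArg Subtype.val (@hinj ⟨d, hd⟩ ⟨e, he⟩ (Subtype.ext hde))
  let s := LinearEquiv.ofBijective _ ⟨hinj, hsurj⟩
  obtain ⟨T, hT⟩ := LinearMap.exists_extend (D.subtype ∘ₗ s.symm.toLinearMap)
  have hTs : ∀ d (hd : d ∈ D), T d = s.symm ⟨d, hd⟩ := fun d hd => congrArg (· ⟨d, hd⟩) hT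
  have hTD : ∀ d ∈ D, T d ∈ D := fun d hd => by
    rw [hTs d hd]
    exact (s.symm ⟨d, hd⟩).2
  have hST : ∀ d ∈ D, S (T d) = d := fun d hd => by
    rw [hTs d hd]
    exact congrArg Subtype.val (s.apply_symm_apply ⟨d, hd⟩)
  have h1 : ∀ c ∈ C, ((T ∘ₗ S) ⋆ S) c = πL c := by
    intro c hc
    refine hinj' _ ?_ _ (hD.piL_mem c) ?_
    · refine apply_mem_of_mem_range_mapIncl (f := mul' K A ∘ₗ TensorProduct.map (T ∘ₗ S) S)
        (fun a ha b hb => ?_) (hC.comul_mem c hc)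
      exact hD.mul_mem _ (hTD _ (hSC a ha)) _ (hSC b hb)
    · rw [antipode_piL_eq_piR_antipode hS, ← antipode_conv_id hS, conv_apply, conv_apply,
        comul_antipode hS]
      refine apply_eq_of_mem_range_mapIncl (f := S ∘ₗ mul' K A ∘ₗ TensorProduct.map (T ∘ₗ S) S)
        (g := mul' K A ∘ₗ TensorProduct.map S LinearMap.id ∘ₗ TensorProduct.map S S ∘ₗ
          (TensorProduct.comm K A A).toLinearMap) (fun a ha b hb => ?_) (hC.comul_mem c hc)
      simp [antipode_mul hS, hST _ (hSC a ha)]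
  intro c hc
  have h2 : ((T ∘ₗ S) ⋆ S ⋆ LinearMap.id) c = c := by
    conv_rhs => rw [← id_apply (R := K) c, ← piL_conv_id hS.1]
    rw [conv_apply, conv_apply]
    refine apply_eq_of_mem_range_mapIncl (f := mul' K A ∘ₗ TensorProduct.map _ _)
      (g := mul' K A ∘ₗ TensorProduct.map _ _) (fun a ha b hb => ?_) (hC.comul_mem c hc)
    simp [h1 a ha]
  have h3 : ((T ∘ₗ S) ⋆ S ⋆ LinearMap.id) c = T (S c) := by
    conv_rhs => rw [← id_apply (R := K) c, ← id_conv_piR hS.1]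
    rw [conv_assoc, antipode_conv_id hS, conv_apply, conv_apply]
    refine apply_eq_of_mem_range_mapIncl (f := mul' K A ∘ₗ TensorProduct.map _ _)
      (g := T ∘ₗ S ∘ₗ mul' K A ∘ₗ TensorProduct.map _ _) (fun a ha b hb => ?_) (hC.comul_mem c hc)
    have hab : a * πR b ∈ C := hC.mul_mem a ha _ (hC.piR_mem b)
    refine hinj' _ (hD.mul_mem _ (hTD _ (hSC a ha)) _ (hD.piR_mem b)) _ (hTD _ (hSC _ hab)) ?_
    change S (T (S a) * πR b) = S (T (S (a * πR b)))
    rw [antipode_mul hS, hST _ (hSC a ha), hST _ (hSC _ hab), antipode_mul hS]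
  rw [← h2, h3]
  exact hTD _ (hSC c hc)

theorem antipode_bijective [FiniteDimensional K A] (hS : WHA S) : Function.Bijective S := by
  let C : ℕ → Submodule K A := fun n => (Submodule.map S)^[n] ⊤
  have hC : ∀ n, C (n + 1) = (C n).map S := fun n => Function.iterate_succ_apply' _ _ _
  have hgood : ∀ n, IsSubbialgebra (C n) := by
    intro n
    induction n with
    | zero => exact IsSubbialgebra.top
    | succ n ih => rw [hC]; exact ih.map_antipode hS
  have hanti : ∀ n, C (n + 1) ≤ C n := by
    intro n
    induction n with
    | zero => exact le_top
    | succ n ih =>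
      rw [hC n, hC (n + 1)]
      exact Submodule.map_mono ih
  have hdescend : ∀ n, C (n + 1) = C n → C 1 = C 0 := by
    intro n
    induction n with
    | zero => exact id
    | succ n ih =>
      intro h
      refine ih (le_antisymm (hanti n) ?_)
      rw [hC]
      refine (hgood n).le_map_antipode hS ?_ ?_
      · rw [← hC]
        exact hanti n
      · rwa [← hC, ← hC]
  obtain ⟨n, hn⟩ := IsArtinian.monotone_stabilizes
    (⟨C, antitone_nat_of_succ_le hanti⟩ : ℕ →o (Submodule K A)ᵒᵈ)
  have hrange : range S = ⊤ := by
    rw [range_eq_map]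
    exact hdescend n (hn (n + 1) n.le_succ).symm
  have hsurj := range_eq_top.1 hrange
  exact ⟨LinearMap.injective_iff_surjective.2 hsurj, hsurj⟩

end Bijective

section Integral

theorem one_tmul_mul_comul_integral (hS : WHA S) {l : A} (hl : ∀ x, x * l = πL x * l) (x : A) :
    (1 ⊗ₜ x) * comul (R := K) l = (S x ⊗ₜ 1) * comul l := by
  have h := hS.toWeakBialgebra
  have e₁ : (incl K A ∘ₗ S) ⋆ incl K A = incl K A ∘ₗ πR := by
    rw [← antipode_conv_id hS, incl_conv, comp_id]
  have e₂ : (incl K A ∘ₗ S) ⋆ (incl K A ∘ₗ πL) = incl K A ∘ₗ S := by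
    rw [← incl_conv, antipode_conv_piL hS]
  have e₃ : mulRight K (comul l) ∘ₗ (comul : A →ₗ[K] A ⊗[K] A) =
      mulRight K (comul l) ∘ₗ (incl K A ∘ₗ πL) := by
    ext y : 1
    simp only [comp_apply, mulRight_apply, incl_apply]
    rw [← h.comul_mul, hl, comul_piL_mul h]
  have key : mulRight K (comul l) ∘ₗ (mulRight K Δ₁ ∘ₗ incr K A) =
      mulRight K (comul l) ∘ₗ (incl K A ∘ₗ S) := by
    rw [← incl_piR_conv_incr h, ← e₁, conv_assoc, ← comul_eq_incl_conv_incr, mulRight_comp_conv,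
      e₃, ← mulRight_comp_conv, e₂]
  simpa [mul_assoc, comul_one_mul h] using congrArg (· x) key

/-- The map `φ ↦ Σ l₍₁₎ φ(l₍₂₎)`. -/
def slice (l : A) : (A →ₗ[K] K) →ₗ[K] A :=
  (TensorProduct.rid K A).toLinearMap ∘ₗ applyₗ (comul l) ∘ₗ lTensorHom A

theorem slice_apply (l : A) (φ : A →ₗ[K] K) :
    slice l φ = TensorProduct.rid K A (φ.lTensor A (comul l)) := rfl

theorem slice_comp_mulLeft (hS : WHA S) {l : A} (hl : ∀ x, x * l = πL x * l) {φ : A →ₗ[K] K}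
    (hφ : slice l φ = 1) (x : A) : slice l (φ ∘ₗ mulLeft K x) = S x := by
  have e₁ : (φ ∘ₗ mulLeft K x).lTensor A (comul l) = φ.lTensor A ((1 ⊗ₜ x) * comul l) := by
    rw [← (ℛ K l).eq]
    simp [Finset.mul_sum]
  have e₂ (t : A ⊗[K] A) : TensorProduct.rid K A (φ.lTensor A ((S x ⊗ₜ 1) * t)) =
      S x * TensorProduct.rid K A (φ.lTensor A t) := by
    induction t with
    | zero => simp
    | tmul => simp
    | add _ _ h₁ h₂ => simp only [map_add, mul_add, h₁, h₂]
  rw [slice_apply, e₁, one_tmul_mul_comul_integral hS hl, e₂, ← slice_apply, hφ, mul_one]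

theorem slice_bijective [FiniteDimensional K A] (hS : WHA S) {l : A}
    (hl : ∀ x, x * l = πL x * l) {φ : A →ₗ[K] K} (hφ : slice l φ = 1) :
    Function.Bijective (slice (K := K) l) := by
  have hsurj : Function.Surjective (slice (K := K) l) := fun a => by
    obtain ⟨x, rfl⟩ := (antipode_bijective hS).2 a
    exact ⟨_, slice_comp_mulLeft hS hl hφ x⟩
  exact ⟨(injective_iff_surjective_of_finrank_eq_finrank Subspace.dual_finrank_eq).2 hsurj, hsurj⟩

theorem lTensor_slice_comul (l : A) (φ : A →ₗ[K] K) :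
    ((TensorProduct.rid K A).toLinearMap ∘ₗ φ.lTensor A ∘ₗ comul).lTensor A (comul l) =
      comul (R := K) (slice l φ) := by
  have e (u : (A ⊗[K] A) ⊗[K] A) :
      ((TensorProduct.rid K A).toLinearMap ∘ₗ φ.lTensor A).lTensor A (TensorProduct.assoc K A A A u) =
        TensorProduct.rid K (A ⊗[K] A) (φ.lTensor (A ⊗[K] A) u) := by
    induction u with
    | zero => simp
    | add _ _ h₁ h₂ => simp only [map_add, h₁, h₂]
    | tmul v c =>
      induction v with
      | zero => simp
      | add _ _ h₁ h₂ => simp only [map_add, TensorProduct.add_tmul, h₁, h₂]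
      | tmul a b => simp
  rw [← comp_assoc, lTensor_comp_apply, ← Coalgebra.coassoc_apply, e, rid_lTensor_rTensor,
    slice_apply]

theorem slice_eq_piL_slice [FiniteDimensional K A] (hS : WHA S) {l : A}
    (hl : ∀ x, x * l = πL x * l) {φ : A →ₗ[K] K} (hφ : slice l φ = 1) (x : A) :
    slice x φ = πL (slice x φ) := by
  set G : A →ₗ[K] A := (TensorProduct.rid K A).toLinearMap ∘ₗ φ.lTensor A ∘ₗ comul with hG
  have hGl : G.lTensor A (comul l) = Δ₁ := by rw [hG, lTensor_slice_comul, hφ]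
  have key (ψ : A →ₗ[K] K) : ψ ∘ₗ G = ψ ∘ₗ πL ∘ₗ G := by
    apply (slice_bijective hS hl hφ).1
    simp only [slice_apply, lTensor_comp_apply, hGl, lTensor_piL_comul_one hS.1]
  rw [← sub_eq_zero, ← Module.forall_dual_apply_eq_zero_iff K]
  intro ψ
  rw [map_sub, sub_eq_zero]
  exact congrArg (· x) (key ψ)

theorem eq_zero_of_forall_apply_mul_right [FiniteDimensional K A] (hS : WHA S) {l : A}
    (hl : ∀ x, x * l = πL x * l) {φ : A →ₗ[K] K} (hφ : slice l φ = 1) (x : A)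
    (hx : ∀ y, φ (x * y) = 0) : x = 0 := by
  apply (antipode_bijective hS).1
  have : φ ∘ₗ mulLeft K x = 0 := LinearMap.ext hx
  rw [← slice_comp_mulLeft hS hl hφ, this, map_zero, map_zero]

theorem eq_zero_of_forall_apply_mul_left [FiniteDimensional K A] (hS : WHA S) {l : A}
    (hl : ∀ x, x * l = πL x * l) {φ : A →ₗ[K] K} (hφ : slice l φ = 1) (y : A)
    (hy : ∀ x, φ (x * y) = 0) : y = 0 := by
  let B : A →ₗ[K] Module.Dual K A := (LinearMap.mul K A).compr₂ φ
  have hinj : Function.Injective B := (injective_iff_map_eq_zero B).2 fun x hx =>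
    eq_zero_of_forall_apply_mul_right hS hl hφ x fun y => congrArg (· y) hx
  have hsurj :=
    (injective_iff_surjective_of_finrank_eq_finrank Subspace.dual_finrank_eq.symm).1 hinj
  refine (Module.forall_dual_apply_eq_zero_iff K y).1 fun ψ => ?_
  obtain ⟨x, rfl⟩ := hsurj ψ
  exact hy x

theorem apply_mul_integral (hS : WHA S) {l : A} (hl : ∀ x, x * l = πL x * l) {φ : A →ₗ[K] K}
    (hφ : slice l φ = 1) (x : A) : φ (x * l) = counit (R := K) x := by
  have e (ψ : A →ₗ[K] K) : counit (R := K) (slice l ψ) = ψ l := by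
    conv_rhs => rw [← sum_counit_left (K := K) l]
    rw [slice_apply, ← (ℛ K l).eq]
    simp only [map_sum, map_smul, lTensor_tmul, TensorProduct.rid_tmul, smul_eq_mul]
    exact Finset.sum_congr rfl fun i _ => mul_comm _ _
  rw [← counit_antipode hS, ← slice_comp_mulLeft hS hl hφ, e]
  rfl

end Integral

end Antipode

end WeakHopf

/-- **duality of left integrals.** Let `l` be a left integral in a weak
Hopf algebra `A` and suppose `λ ∈ A*` satisfies `Σ l₍₁₎ λ(l₍₂₎) = 1`.  Then `λ` is
unique with this property; `λ` is a left integral in the dual weak Hopf algebra, i.e.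
`Σ x₍₁₎ λ(x₍₂₎) = Σ Π^L(x₍₁₎) λ(x₍₂₎)` for all `x`; `l` is nondegenerate; the bilinear
form `(x, y) ↦ λ(xy)` is nondegenerate; and `λ(x l) = ε(x)` for all `x`. -/
theorem weakHopfAlgebra_dual_pair_of_left_integrals
    (K : Type*) [Field K] (A : Type*) [Ring A] [Algebra K A] [FiniteDimensional K A]
    (Δ : A →ₗ[K] A ⊗[K] A) (ε : A →ₗ[K] K) (S : A →ₗ[K] A)
    (hA : WeakHopfAlgebra K A Δ ε S)
    (l : A) (hl : ∀ x : A, x * l = piL K A Δ ε x * l)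
    (lam : A →ₗ[K] K)
    (hlam : (TensorProduct.rid K A) (LinearMap.lTensor A lam (Δ l)) = 1) :
    (∀ lam' : A →ₗ[K] K,
      (TensorProduct.rid K A) (LinearMap.lTensor A lam' (Δ l)) = 1 → lam' = lam) ∧
    (∀ x : A,
      (TensorProduct.rid K A) (LinearMap.lTensor A lam (Δ x)) =
      (TensorProduct.rid K A)
        (LinearMap.lTensor A lam (LinearMap.rTensor A (piL K A Δ ε) (Δ x)))) ∧
    Function.Bijective
      (fun φ : A →ₗ[K] K => (TensorProduct.rid K A) (LinearMap.lTensor A φ (Δ l))) ∧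
    (∀ x : A, (∀ y : A, lam (x * y) = 0) → x = 0) ∧
    (∀ y : A, (∀ x : A, lam (x * y) = 0) → y = 0) ∧
    (∀ x : A, lam (x * l) = ε x) := by
  have h := hA.toWeakBialgebra
  let _ : Coalgebra K A :=
    { comul := Δ
      counit := ε
      coassoc := LinearMap.ext h.coassoc
      rTensor_counit_comp_comul := LinearMap.ext fun x =>
        (TensorProduct.lid K A).injective <| by simpa using h.counit_left x
      lTensor_counit_comp_comul := LinearMap.ext fun x =>
        (TensorProduct.rid K A).injective <| by simpa using h.counit_right x }
  have hbij := WeakHopf.slice_bijective hA hl hlam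
  refine ⟨fun lam' h' => hbij.1 (h'.trans hlam.symm), fun x => ?_, hbij,
    WeakHopf.eq_zero_of_forall_apply_mul_right hA hl hlam,
    WeakHopf.eq_zero_of_forall_apply_mul_left hA hl hlam,
    WeakHopf.apply_mul_integral hA hl hlam⟩
  rw [WeakHopf.rid_lTensor_rTensor]
  exact WeakHopf.slice_eq_piL_slice hA hl hlam x
end
end
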